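/- arXiv:1306.4104 — 3 statements merged into one kernel-verified Lean document; each statement's English description precedes it below -/
import Mathlib

section
/- Let n ≥ 2 be an even integer and p an odd prime with p ≥ n/2 + 1. Then for every integer r ≥ 2, S_n(p^r) = C(n−1, n/2 − 1) · ((p−1)/p) · p^{(n/2 + 1)r}, where C(a,b) denotes the binomial coefficient. -/
open Finset

/-- The Kloosterman sum `K(u,v;q) = ∑_{x ∈ (ℤ/qℤ)^*} e^{2πi(ux + v x̄)/q}`. -/
noncomputable def Kl (q : ℕ) (u v : ℤ) : ℂ :=
  ∑ x ∈ Finset.range q,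
    if Nat.Coprime x q then
      Complex.exp (2 * Real.pi * Complex.I *
        ((u : ℂ) * (x : ℂ) + (v : ℂ) * ((((x : ZMod q)⁻¹ : ZMod q).val : ℕ) : ℂ)) / (q : ℂ))
    else 0

/-- The `n`-th power moment `S_n(q) = ∑_{u=1}^q K(u,1;q)^n`. -/
noncomputable def S (n q : ℕ) : ℂ :=
  ∑ u ∈ Finset.range q, Kl q ((u : ℤ) + 1) 1 ^ n

section AbstractKloosterman

variable {R k : Type*} [CommRing R] [Field k]
  {π : R →+* k} {ψ : AddChar R ℂ} {ϖ : R}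

theorem addChar_mul_eq_of_map_eq (hϖ : ∀ y, ϖ * y = 0 ↔ π y = 0) {y z : R} (h : π y = π z) :
    ψ (ϖ * y) = ψ (ϖ * z) := by
  have : ϖ * (y - z) = 0 := (hϖ _).2 (by simp [h])
  rw [mul_sub, sub_eq_zero] at this
  rw [this]

theorem map_unit_inv (x : Rˣ) : π ((x⁻¹ : Rˣ) : R) = (π x)⁻¹ := by
  have h : π x * π ((x⁻¹ : Rˣ) : R) = 1 := by rw [← map_mul]; simp
  exact eq_inv_of_mul_eq_one_right h

theorem map_unit_ne_zero (x : Rˣ) : π x ≠ 0 := (x.isUnit.map π).ne_zero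

theorem unit_eq_or_eq_neg_of_sq_eq_sq (hloc : ∀ x, π x ≠ 0 → IsUnit x) (h2 : (2 : k) ≠ 0)
    {x y : Rˣ} (h : x ^ 2 = y ^ 2) : x = y ∨ x = -y := by
  have hxy : ((x : R) - y) * (x + y) = 0 := by
    have : (x : R) ^ 2 = y ^ 2 := by exact_mod_cast congrArg Units.val h
    linear_combination this
  by_cases hu : π ((x : R) - y) = 0
  · left
    have hu' : π ((x : R) + y) ≠ 0 := by
      intro h0
      apply mul_ne_zero h2 (map_unit_ne_zero (π := π) x)
      simp only [map_sub, map_add] at hu h0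
      linear_combination hu + h0
    ext
    exact sub_eq_zero.1 ((hloc _ hu').mul_left_eq_zero.1 hxy)
  · right
    ext
    simpa using eq_neg_of_add_eq_zero_left ((hloc _ hu).mul_right_eq_zero.1 hxy)

theorem unit_eq_of_sq_eq_sq_of_map_eq_one (hloc : ∀ x, π x ≠ 0 → IsUnit x) (h2 : (2 : k) ≠ 0)
    {x y : Rˣ} (hx : π x = 1) (hy : π y = 1) (h : x ^ 2 = y ^ 2) : x = y := by
  rcases unit_eq_or_eq_neg_of_sq_eq_sq hloc h2 h with h | h
  · exact h
  · exfalso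
    apply h2
    have : π x = - π y := by rw [h]; simp
    rw [hx, hy] at this
    linear_combination this

variable [Fintype R] [DecidableEq R]

theorem card_unit_sq_eq (hloc : ∀ x, π x ≠ 0 → IsUnit x) (h2 : (2 : k) ≠ 0) (s : Rˣ) :
    #{t : Rˣ | (t : R) ^ 2 = (s : R) ^ 2} = 2 := by
  have hs : s ≠ -s := by
    intro h
    have h' : π s = -π s := by
      conv_lhs => rw [h]
      simp
    apply mul_ne_zero h2 (map_unit_ne_zero (π := π) s)
    linear_combination h'
  suffices h : ({t : Rˣ | (t : R) ^ 2 = (s : R) ^ 2} : Finset Rˣ) = {s, -s} by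
    rw [h, Finset.card_pair hs]
  ext t
  simp only [Finset.mem_filter, Finset.mem_univ, true_and, Finset.mem_insert,
    Finset.mem_singleton]
  constructor
  · intro h
    exact unit_eq_or_eq_neg_of_sq_eq_sq hloc h2 (Units.ext (by simpa using h))
  · rintro (rfl | rfl) <;> simp

variable [DecidableEq k]

/-- The units of `R` that reduce to `c`. -/
def unitClass (π : R →+* k) (c : k) : Finset Rˣ := Finset.univ.filter fun x : Rˣ => π x = c

@[simp]
theorem mem_unitClass {c : k} {x : Rˣ} : x ∈ unitClass π c ↔ π x = c := by
  simp [unitClass]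

/-- The terms of a Kloosterman sum lying over a residue class that is not a critical point
cancel. -/
theorem sum_class_eq_zero (hψ : ∀ y, ψ y = 1 → y = 0) (hϖ : ∀ y, ϖ * y = 0 ↔ π y = 0)
    (hϖ0 : π ϖ = 0) (u v : R) (c : k) (hc : π u * c ^ 2 ≠ π v) :
    ∑ x ∈ unitClass π c, ψ (u * x + v * ((x⁻¹ : Rˣ) : R)) = 0 := by
  have hsq : ϖ * ϖ = 0 := (hϖ ϖ).2 hϖ0
  let w : Rˣ := ⟨1 + ϖ, 1 - ϖ, by linear_combination -hsq, by linear_combination -hsq⟩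
  by_cases hne : ∃ x₀ : Rˣ, π x₀ = c
  swap
  · refine Finset.sum_eq_zero fun x hx => ?_
    exact absurd ⟨x, mem_unitClass.1 hx⟩ hne
  obtain ⟨x₀, hx₀⟩ := hne
  have key : ∑ x ∈ unitClass π c, ψ (u * x + v * ((x⁻¹ : Rˣ) : R)) =
      ψ (ϖ * (u * x₀ - v * ((x₀⁻¹ : Rˣ) : R))) *
        ∑ x ∈ unitClass π c, ψ (u * x + v * ((x⁻¹ : Rˣ) : R)) := by
    rw [Finset.mul_sum]
    symm
    refine Finset.sum_equiv (Equiv.mulRight w⁻¹).symm ?_ ?_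
    · intro x
      simp [w, hϖ0]
    · intro x hx
      rw [mem_unitClass] at hx
      rw [addChar_mul_eq_of_map_eq (z := u * x - v * ((x⁻¹ : Rˣ) : R)) hϖ
        (by simp [hx, hx₀]), ← AddChar.map_add_eq_mul]
      congr 1
      simp [w]
      ring
  have hne1 : ψ (ϖ * (u * x₀ - v * ((x₀⁻¹ : Rˣ) : R))) ≠ 1 := by
    intro h
    have h0 := (hϖ _).1 (hψ _ h)
    have hc0 : c ≠ 0 := hx₀ ▸ map_unit_ne_zero x₀
    simp only [map_sub, map_mul, map_unit_inv, hx₀] at h0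
    apply hc
    field_simp at h0
    linear_combination h0
  by_contra h0
  exact hne1 (mul_right_cancel₀ h0 (by rw [one_mul]; exact key.symm))

/-- The Kloosterman sum over `R` attached to the additive character `ψ`. -/
def klSum (ψ : AddChar R ℂ) (u : R) : ℂ := ∑ x : Rˣ, ψ (u * x + ((x⁻¹ : Rˣ) : R))

/-- The part of the Kloosterman sum with parameters `s, s` over the critical class of `1`. -/
def critSum (π : R →+* k) (ψ : AddChar R ℂ) (s : R) : ℂ :=
  ∑ x ∈ unitClass π 1, ψ (s * (x + ((x⁻¹ : Rˣ) : R)))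

theorem sum_eq_sum_image_classes (f : Rˣ → ℂ) (T : Finset k)
    (h : ∀ c ∉ T, ∑ x ∈ unitClass π c, f x = 0) :
    ∑ x : Rˣ, f x = ∑ c ∈ T, ∑ x ∈ unitClass π c, f x := by
  classical
  simp only [unitClass]
  rw [← Finset.sum_fiberwise_of_maps_to (s := Finset.univ)
    (t := T ∪ Finset.univ.image fun x : Rˣ => π x) (g := fun x : Rˣ => π x) (by simp)]
  exact (Finset.sum_subset Finset.subset_union_left fun c _ hc => h c hc).symm

theorem klSum_eq_zero (hψ : ∀ y, ψ y = 1 → y = 0) (hϖ : ∀ y, ϖ * y = 0 ↔ π y = 0)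
    (hϖ0 : π ϖ = 0) {u : R} (hu : ∀ c, π u * c ^ 2 ≠ 1) : klSum ψ u = 0 := by
  unfold klSum
  rw [sum_eq_sum_image_classes (π := π) _ ∅, Finset.sum_empty]
  intro c _
  simpa using sum_class_eq_zero (v := 1) hψ hϖ hϖ0 u c (by simpa using hu c)

theorem klSum_sq (hψ : ∀ y, ψ y = 1 → y = 0) (hϖ : ∀ y, ϖ * y = 0 ↔ π y = 0)
    (hϖ0 : π ϖ = 0) (h2 : (2 : k) ≠ 0) (s : Rˣ) :
    klSum ψ ((s : R) ^ 2) = critSum π ψ s + critSum π ψ (-s) := by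
  have h1 : klSum ψ ((s : R) ^ 2) = ∑ x : Rˣ, ψ (s * x + s * ((x⁻¹ : Rˣ) : R)) := by
    refine Fintype.sum_equiv (Equiv.mulLeft s) _ _ fun x => ?_
    congr 1
    simp only [Equiv.coe_mulLeft, mul_inv, Units.val_mul]
    linear_combination -((x⁻¹ : Rˣ) : R) * s.mul_inv
  have hne : (1 : k) ≠ -1 := by
    intro h
    apply h2
    linear_combination h
  rw [h1, sum_eq_sum_image_classes (π := π) _ {1, -1}, Finset.sum_pair hne]
  · congr 1
    · simp only [critSum, mul_add]
    · refine Finset.sum_equiv (Equiv.neg _) ?_ ?_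
      · intro x
        simp [neg_eq_iff_eq_neg]
      · intro x _
        congr 1
        simp
        ring
  · intro c hc
    refine sum_class_eq_zero hψ hϖ hϖ0 _ _ c ?_
    intro h
    apply hc
    have : c ^ 2 = 1 := by
      apply mul_left_cancel₀ (map_unit_ne_zero (π := π) s)
      rw [h, mul_one]
    simpa using sq_eq_one_iff.1 this

theorem critSum_add (hϖ : ∀ y, ϖ * y = 0 ↔ π y = 0) (s : R) :
    critSum π ψ (s + ϖ) = ψ (ϖ * 2) * critSum π ψ s := by
  unfold critSum
  rw [Finset.mul_sum]
  refine Finset.sum_congr rfl fun x hx => ?_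
  rw [mem_unitClass] at hx
  rw [addChar_mul_eq_of_map_eq (z := x + ((x⁻¹ : Rˣ) : R)) hϖ
    (by simp [hx, one_add_one_eq_two, map_ofNat]), ← AddChar.map_add_eq_mul]
  congr 1
  ring

theorem sum_sub_inv (hloc : ∀ x, π x ≠ 0 → IsUnit x) (h2 : (2 : k) ≠ 0) (f : R → ℂ) :
    ∑ x ∈ unitClass π 1, f (x - ((x⁻¹ : Rˣ) : R)) = ∑ a : R with π a = 0, f a := by
  have hmaps : Set.MapsTo (fun x : Rˣ => (x : R) - ((x⁻¹ : Rˣ) : R))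
      (unitClass π (1 : k)) ({a : R | π a = 0} : Finset R) := by
    intro x hx
    simp at hx
    simp [hx]
  have hinj : Set.InjOn (fun x : Rˣ => (x : R) - ((x⁻¹ : Rˣ) : R))
      (unitClass π (1 : k)) := by
    intro x hx y hy hxy
    simp at hx hy hxy
    have hu : IsUnit (1 + ((x⁻¹ : Rˣ) : R) * ((y⁻¹ : Rˣ) : R)) := by
      apply hloc
      simp only [map_add, map_one, map_mul, map_unit_inv, hx, hy]
      norm_num [h2]
    ext
    rw [← sub_eq_zero]
    apply hu.mul_left_eq_zero.1
    linear_combination hxy + ((y⁻¹ : Rˣ) : R) * x.mul_inv - ((x⁻¹ : Rˣ) : R) * y.mul_inv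
  have hcard : #{a : R | π a = 0} ≤ #(unitClass π (1 : k)) := by
    refine Finset.card_le_card_of_surjOn (fun x => (x : R) - 1) ?_
    intro a ha
    simp at ha
    obtain ⟨x, hx⟩ := hloc (1 + a) (by simp [ha])
    exact ⟨x, by simp [hx, ha], by simp [hx]⟩
  exact Finset.sum_nbij _ hmaps hinj (Finset.surjOn_of_injOn_of_card_le _ hmaps hinj hcard)
    fun _ _ => rfl

theorem critSum_mul_critSum_neg (hloc : ∀ x, π x ≠ 0 → IsUnit x) (h2 : (2 : k) ≠ 0) (s : R) :
    critSum π ψ s * critSum π ψ (-s) =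
      ∑ a : R with π a = 0, ∑ b : R with π b = 0, ψ (s * a * b) := by
  set U : Finset Rˣ := unitClass π 1
  have hU : ∀ x, x ∈ U ↔ π x = 1 := fun x => mem_unitClass
  have hmaps : Set.MapsTo (fun z : Rˣ × Rˣ => (z.1 * z.2, z.1 * z.2⁻¹))
      (U ×ˢ U : Finset (Rˣ × Rˣ)) (U ×ˢ U : Finset (Rˣ × Rˣ)) := by
    rintro ⟨x, y⟩ h
    simp [hU] at h
    simp [hU, h]
  have hinj : Set.InjOn (fun z : Rˣ × Rˣ => (z.1 * z.2, z.1 * z.2⁻¹))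
      (U ×ˢ U : Finset (Rˣ × Rˣ)) := by
    rintro ⟨x, y⟩ h ⟨x', y'⟩ h' hxy
    simp [hU] at h h'
    simp only [Prod.mk.injEq] at hxy
    have hx : x = x' := by
      apply unit_eq_of_sq_eq_sq_of_map_eq_one hloc h2 h.1 h'.1
      calc x ^ 2 = (x * y) * (x * y⁻¹) := by rw [mul_mul_mul_comm]; simp [sq]
        _ = (x' * y') * (x' * y'⁻¹) := by rw [hxy.1, hxy.2]
        _ = x' ^ 2 := by rw [mul_mul_mul_comm]; simp [sq]
    subst hx
    simpa using hxy.1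
  have hprod : critSum π ψ s * critSum π ψ (-s) = ∑ z ∈ U ×ˢ U,
      ψ (s * (z.1 + ((z.1⁻¹ : Rˣ) : R)) + -s * (z.2 + ((z.2⁻¹ : Rˣ) : R))) := by
    simp only [critSum, Finset.sum_mul_sum, Finset.sum_product, AddChar.map_add_eq_mul, U]
  rw [hprod, ← sum_sub_inv hloc h2]
  simp_rw [← sum_sub_inv hloc h2]
  rw [← Finset.sum_product']
  symm
  refine Finset.sum_nbij _ hmaps hinj
    (Finset.surjOn_of_injOn_of_card_le _ hmaps hinj le_rfl) ?_
  rintro ⟨x, y⟩ -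
  congr 1
  simp
  ring

theorem sum_sum_addChar_mul (hψ : ∀ y, ψ y = 1 → y = 0) {g : R}
    (hg : ∀ x, π x = 0 ↔ ∃ t, g * t = x) (hg0 : ∀ a, g * a = 0 → π a = 0) (s : Rˣ) :
    ∑ a : R with π a = 0, ∑ b : R with π b = 0, ψ (s * a * b) = Fintype.card R := by
  have hgπ : π g = 0 := (hg g).2 ⟨1, mul_one g⟩
  have inner : ∀ a : R, ∑ b : R with π b = 0, ψ (s * a * b) =
      if g * a = 0 then (#{b : R | π b = 0} : ℂ) else 0 := by
    intro a
    split_ifs with ha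
    · rw [← nsmul_one, ← Finset.sum_const]
      refine Finset.sum_congr rfl fun b hb => ?_
      simp only [Finset.mem_filter, Finset.mem_univ, true_and] at hb
      obtain ⟨t, rfl⟩ := (hg b).1 hb
      rw [show s * a * (g * t) = (g * a) * (s * t) by ring, ha, zero_mul, AddChar.map_zero_eq_one]
    · have key : ∑ b : R with π b = 0, ψ (s * a * b) =
          ψ (s * a * g) * ∑ b : R with π b = 0, ψ (s * a * b) := by
        rw [Finset.mul_sum]
        symm
        refine Finset.sum_equiv (Equiv.addRight g) ?_ ?_
        · intro x
          simp [hgπ]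
        · intro x _
          rw [← AddChar.map_add_eq_mul]
          congr 1
          simp
          ring
      by_contra h0
      have h1 := hψ _ (mul_right_cancel₀ h0 (by rw [one_mul]; exact key.symm))
      rw [mul_assoc, s.isUnit.mul_right_eq_zero, mul_comm] at h1
      exact ha h1
  simp_rw [inner]
  rw [← Finset.sum_filter, Finset.filter_filter, Finset.sum_const, nsmul_eq_mul]
  norm_cast
  have hann : ({a : R | π a = 0 ∧ g * a = 0} : Finset R) = ({a : R | g * a = 0} : Finset R) := by
    ext a
    simpa using hg0 a
  rw [hann, ← Finset.card_univ, Finset.card_eq_sum_card_fiberwise (s := Finset.univ)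
    (f := fun t : R => g * t) (t := ({b : R | π b = 0} : Finset R)) (by intro t; simp [hgπ]), mul_comm,
    ← smul_eq_mul]
  symm
  refine Finset.sum_eq_card_nsmul fun b hb => ?_
  simp only [Finset.mem_filter, Finset.mem_univ, true_and] at hb
  obtain ⟨t, rfl⟩ := (hg b).1 hb
  refine Finset.card_equiv (Equiv.subRight t) fun x => ?_
  simp [mul_sub, sub_eq_zero]

theorem sum_units_eq_sum_filter (hloc : ∀ x, π x ≠ 0 → IsUnit x) (f : R → ℂ) :
    ∑ s : Rˣ, f s = ∑ s : R with π s ≠ 0, f s := by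
  refine Finset.sum_nbij (fun s : Rˣ => (s : R)) ?_ (fun x _ y _ h => Units.ext h) ?_
    fun _ _ => rfl
  · intro x _
    simpa using map_unit_ne_zero x
  · intro x hx
    simp only [Finset.coe_filter, Finset.mem_univ, true_and, Set.mem_ofPred_eq] at hx
    obtain ⟨y, rfl⟩ := hloc x hx
    exact ⟨y, by simp, rfl⟩

theorem sum_critSum_pow_mul_eq_zero (hloc : ∀ x, π x ≠ 0 → IsUnit x)
    (hψ : ∀ y, ψ y = 1 → y = 0) (hϖ : ∀ y, ϖ * y = 0 ↔ π y = 0) (hϖ0 : π ϖ = 0)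
    (h2 : (2 : k) ≠ 0) {i j : ℕ} (hij : (i : k) ≠ j) :
    ∑ s : Rˣ, critSum π ψ s ^ i * critSum π ψ (-s) ^ j = 0 := by
  rw [sum_units_eq_sum_filter (π := π) hloc fun s => critSum π ψ s ^ i * critSum π ψ (-s) ^ j]
  set f : R → ℂ := fun s => critSum π ψ s ^ i * critSum π ψ (-s) ^ j with hf
  have hshift : ∀ s, ψ (ϖ * 2) ^ j * f (s + ϖ) = ψ (ϖ * 2) ^ i * f s := by
    intro s
    have h := critSum_add (ψ := ψ) hϖ (-(s + ϖ))
    rw [neg_add, neg_add_cancel_right] at h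
    simp only [hf]
    rw [critSum_add hϖ, neg_add, h, mul_pow, mul_pow]
    ring
  have key : ψ (ϖ * 2) ^ j * ∑ s : R with π s ≠ 0, f s =
      ψ (ϖ * 2) ^ i * ∑ s : R with π s ≠ 0, f s := by
    calc _ = ψ (ϖ * 2) ^ j * ∑ s : R with π s ≠ 0, f (s + ϖ) := by
          congr 1
          symm
          refine Finset.sum_equiv (Equiv.addRight ϖ) ?_ fun _ _ => rfl
          intro x
          simp [hϖ0]
      _ = _ := by simp_rw [Finset.mul_sum, hshift]
  by_contra h0
  have h := mul_right_cancel₀ h0 key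
  rw [← AddChar.map_nsmul_eq_pow, ← AddChar.map_nsmul_eq_pow] at h
  have h1 : ψ (ϖ * (2 * i - 2 * j)) = 1 := by
    have h3 : ϖ * (2 * i - 2 * j) + j • (ϖ * 2) = i • (ϖ * 2) := by
      simp only [nsmul_eq_mul]
      ring
    have h4 := AddChar.map_add_eq_mul ψ (ϖ * (2 * i - 2 * j)) (j • (ϖ * 2))
    rw [h3, ← h] at h4
    exact (mul_eq_right₀ (AddChar.val_isUnit _ _).ne_zero).1 h4.symm
  have h5 := (hϖ _).1 (hψ _ h1)
  apply hij
  apply mul_left_cancel₀ h2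
  simpa [sub_eq_zero, map_ofNat, h2] using h5

theorem sum_klSum_sq_pow (hloc : ∀ x, π x ≠ 0 → IsUnit x)
    (hψ : ∀ y, ψ y = 1 → y = 0) (hϖ : ∀ y, ϖ * y = 0 ↔ π y = 0) (hϖ0 : π ϖ = 0)
    (h2 : (2 : k) ≠ 0) {g : R} (hg : ∀ x, π x = 0 ↔ ∃ t, g * t = x)
    (hg0 : ∀ a, g * a = 0 → π a = 0) {m : ℕ}
    (hm : ∀ i j : ℕ, i + j = 2 * m → (i : k) = j → i = j) :
    ∑ s : Rˣ, klSum ψ ((s : R) ^ 2) ^ (2 * m) =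
      (2 * m).choose m * (Fintype.card R : ℂ) ^ m * Fintype.card Rˣ := by
  simp_rw [klSum_sq hψ hϖ hϖ0 h2, (Commute.all (critSum π ψ _) (critSum π ψ (-_))).add_pow']
  rw [Finset.sum_comm, Finset.sum_eq_single (m, m)]
  · simp_rw [← mul_pow, critSum_mul_critSum_neg hloc h2, sum_sum_addChar_mul hψ hg hg0]
    simp
    ring
  · rintro ⟨i, j⟩ hmem hne
    rw [Finset.HasAntidiagonal.mem_antidiagonal] at hmem
    rw [← Finset.smul_sum, sum_critSum_pow_mul_eq_zero hloc hψ hϖ hϖ0 h2, smul_zero]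
    intro h
    have := hm i j hmem h
    apply hne
    simp only [Prod.mk.injEq]
    simp only at hmem
    omega
  · intro h
    simp [two_mul] at h

theorem exists_unit_sq_eq (hloc : ∀ x, π x ≠ 0 → IsUnit x) (h2 : (2 : k) ≠ 0)
    (hsurj : Function.Surjective π) {u : R} {c : k} (hc : π u * c ^ 2 = 1) :
    ∃ s : Rˣ, (s : R) ^ 2 = u := by
  have hmaps : Set.MapsTo (fun x : Rˣ => x ^ 2) (unitClass π (1 : k)) (unitClass π (1 : k)) := by
    intro x hx
    simp at hx
    simp [hx]
  have hinj : Set.InjOn (fun x : Rˣ => x ^ 2) (unitClass π (1 : k)) := by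
    intro x hx y hy hxy
    simp at hx hy
    exact unit_eq_of_sq_eq_sq_of_map_eq_one hloc h2 hx hy hxy
  have hc0 : c ≠ 0 := by
    rintro rfl
    simp at hc
  obtain ⟨y, rfl⟩ := hsurj c
  obtain ⟨y, rfl⟩ := hloc y hc0
  obtain ⟨v, hv⟩ := hloc (u * (y : R) ^ 2) (by simp [hc])
  obtain ⟨w, -, hw⟩ := Finset.surjOn_of_injOn_of_card_le _ hmaps hinj le_rfl
    (show v ∈ (unitClass π (1 : k) : Set Rˣ) by simp [hv, hc])
  refine ⟨w * y⁻¹, ?_⟩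
  have hw' : (w : R) ^ 2 = u * (y : R) ^ 2 := by
    rw [← hv, ← hw]
    simp
  calc ((w * y⁻¹ : Rˣ) : R) ^ 2 = (w : R) ^ 2 * ((y⁻¹ : Rˣ) : R) ^ 2 := by simp [mul_pow]
    _ = u * ((y : R) * ((y⁻¹ : Rˣ) : R)) ^ 2 := by rw [hw']; ring
    _ = u := by simp

theorem sum_klSum_sq_pow_eq_two_mul (hloc : ∀ x, π x ≠ 0 → IsUnit x)
    (hsurj : Function.Surjective π) (hψ : ∀ y, ψ y = 1 → y = 0)
    (hϖ : ∀ y, ϖ * y = 0 ↔ π y = 0) (hϖ0 : π ϖ = 0) (h2 : (2 : k) ≠ 0) {n : ℕ} (hn : n ≠ 0) :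
    ∑ s : Rˣ, klSum ψ ((s : R) ^ 2) ^ n = 2 * ∑ u : R, klSum ψ u ^ n := by
  rw [← Finset.sum_fiberwise' Finset.univ (fun s : Rˣ => (s : R) ^ 2) fun u => klSum ψ u ^ n,
    Finset.mul_sum]
  refine Finset.sum_congr rfl fun u _ => ?_
  rw [Finset.sum_const, nsmul_eq_mul]
  by_cases hu : ∃ c, π u * c ^ 2 = 1
  · obtain ⟨c, hc⟩ := hu
    obtain ⟨s, rfl⟩ := exists_unit_sq_eq hloc h2 hsurj hc
    rw [card_unit_sq_eq hloc h2]
    norm_num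
  · rw [klSum_eq_zero hψ hϖ hϖ0 (not_exists.1 hu)]
    simp [hn]

end AbstractKloosterman

theorem ZMod.sum_range_natCast {M : Type*} [AddCommMonoid M] (q : ℕ) [NeZero q]
    (f : ZMod q → M) : ∑ x ∈ Finset.range q, f x = ∑ x : ZMod q, f x := by
  refine Finset.sum_nbij' (fun x => (x : ZMod q)) ZMod.val ?_ ?_ ?_ ?_ ?_
  · simp
  · intro a _
    simpa using ZMod.val_lt a
  · intro a ha
    exact ZMod.val_cast_of_lt (by simpa using ha)
  · intro a _
    simp
  · simp

theorem Kl_eq_klSum (q : ℕ) [NeZero q] (u : ℤ) :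
    Kl q u 1 = klSum ZMod.stdAddChar (u : ZMod q) := by
  classical
  have hterm : ∀ x : ℕ, (if Nat.Coprime x q then
      Complex.exp (2 * Real.pi * Complex.I *
        ((u : ℂ) * (x : ℂ) + ((1 : ℤ) : ℂ) * ((((x : ZMod q)⁻¹ : ZMod q).val : ℕ) : ℂ)) / (q : ℂ))
      else 0) = (fun y : ZMod q =>
        if IsUnit y then ZMod.stdAddChar ((u : ZMod q) * y + y⁻¹) else 0) (x : ZMod q) := by
    intro x
    simp only [ZMod.isUnit_iff_coprime]
    congr 1
    have h := ZMod.stdAddChar_coe (N := q) (u * x + ((x : ZMod q)⁻¹ : ZMod q).val)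
    simp only [Int.cast_add, Int.cast_mul, Int.cast_natCast,
      ZMod.natCast_zmod_val] at h
    rw [h]
    simp
  unfold Kl klSum
  rw [Finset.sum_congr rfl fun x _ => hterm x, ZMod.sum_range_natCast q fun y =>
    if IsUnit y then ZMod.stdAddChar ((u : ZMod q) * y + y⁻¹) else 0, ← Finset.sum_filter]
  symm
  refine Finset.sum_nbij (fun s : (ZMod q)ˣ => (s : ZMod q)) ?_ (fun x _ y _ h => Units.ext h) ?_ ?_
  · intro x _
    simp
  · intro x hx
    obtain ⟨y, rfl⟩ := (Finset.mem_filter.1 (Finset.mem_coe.1 hx)).2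
    exact ⟨y, by simp, rfl⟩
  · intro x _
    rw [ZMod.inv_coe_unit]

theorem S_eq_sum_klSum (n q : ℕ) [NeZero q] :
    S n q = ∑ u : ZMod q, klSum ZMod.stdAddChar u ^ n := by
  unfold S
  simp_rw [Kl_eq_klSum]
  rw [← Equiv.sum_comp (Equiv.addRight (1 : ZMod q)), ← ZMod.sum_range_natCast]
  simp

theorem ZMod.castHom_eq_zero_iff_dvd_val {d q : ℕ} [NeZero q] (h : d ∣ q) (x : ZMod q) :
    ZMod.castHom h (ZMod d) x = 0 ↔ d ∣ x.val := by
  rw [← ZMod.natCast_eq_zero_iff]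
  conv_lhs => rw [← ZMod.natCast_zmod_val x, map_natCast]

theorem ZMod.natCast_mul_eq_zero_iff {q : ℕ} [NeZero q] (d : ℕ) (x : ZMod q) :
    (d : ZMod q) * x = 0 ↔ q ∣ d * x.val := by
  rw [← ZMod.natCast_eq_zero_iff, Nat.cast_mul, ZMod.natCast_zmod_val]

theorem natCast_zmod_inj_of_add_eq_two_mul {p m : ℕ} (hp : p.Prime) (hp2 : p ≠ 2) (hm : m < p)
    {i j : ℕ} (hij : i + j = 2 * m) (h : (i : ZMod p) = j) : i = j := by
  have h1 : (p : ℤ) ∣ 2 * ((i : ℤ) - m) := by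
    have h2 : (((j : ℤ) - (i : ℤ) : ℤ) : ZMod p) = 0 := by
      push_cast
      rw [h, sub_self]
    have h3 := (ZMod.intCast_zmod_eq_zero_iff_dvd _ p).1 h2
    rwa [← dvd_neg, show -(2 * ((i : ℤ) - m)) = j - i by omega]
  have h2 : (p : ℤ) ∣ (i : ℤ) - m := by
    refine IsCoprime.dvd_of_dvd_mul_left ?_ h1
    exact Nat.isCoprime_iff_coprime.2 <| (Nat.coprime_primes hp Nat.prime_two).2 hp2
  have h3 : (i : ℤ) - m = 0 := by
    refine Int.eq_zero_of_abs_lt_dvd h2 ?_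
    rw [abs_lt]
    omega
  omega

/-- Let `n ≥ 2` be even and `p` an odd prime with `p ≥ n/2 + 1`. Then for every `r ≥ 2`,
`S_n(p^r) = C(n−1, n/2−1)·((p−1)/p)·p^((n/2+1)r)`. -/
theorem even_moment_large_prime (n p r : ℕ) (hn : 2 ≤ n) (heven : Even n)
    (hp : p.Prime) (hpodd : p ≠ 2) (hpn : n / 2 + 1 ≤ p) (hr : 2 ≤ r) :
    S n (p ^ r) =
      (Nat.choose (n - 1) (n / 2 - 1) : ℂ) * (((p : ℂ) - 1) / (p : ℂ)) *
        (p : ℂ) ^ ((n / 2 + 1) * r) := by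
  obtain ⟨m, rfl⟩ := heven.exists_two_nsmul
  obtain ⟨t, rfl⟩ : ∃ t, r = t + 2 := ⟨r - 2, by omega⟩
  simp only [smul_eq_mul] at *
  rw [Nat.mul_div_cancel_left _ two_pos] at *
  have : Fact p.Prime := ⟨hp⟩
  have : NeZero (p ^ (t + 2)) := ⟨pow_ne_zero _ hp.ne_zero⟩
  let π := ZMod.castHom (dvd_pow_self p (by omega : t + 2 ≠ 0)) (ZMod p)
  have hπ : ∀ x, π x = 0 ↔ p ∣ x.val := fun x => ZMod.castHom_eq_zero_iff_dvd_val _ x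
  have hloc : ∀ x, π x ≠ 0 → IsUnit x := by
    intro x hx
    rw [← ZMod.natCast_zmod_val x, ZMod.isUnit_iff_coprime]
    rw [Ne, hπ] at hx
    exact ((hp.coprime_iff_not_dvd.2 hx).symm).pow_right _
  have hsurj : Function.Surjective π := ZMod.castHom_surjective _
  have hψ : ∀ y : ZMod (p ^ (t + 2)), ZMod.stdAddChar y = 1 → y = 0 := by
    intro y hy
    exact ZMod.injective_stdAddChar (hy.trans (AddChar.map_zero_eq_one _).symm)
  have hϖ : ∀ y, ((p ^ (t + 1) : ℕ) : ZMod (p ^ (t + 2))) * y = 0 ↔ π y = 0 := by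
    intro y
    rw [ZMod.natCast_mul_eq_zero_iff, hπ]
    exact Nat.mul_dvd_mul_iff_left (pow_pos hp.pos (t + 1))
  have hϖ0 : π ((p ^ (t + 1) : ℕ) : ZMod (p ^ (t + 2))) = 0 := by
    rw [map_natCast, ZMod.natCast_eq_zero_iff]
    exact dvd_pow_self p (by omega)
  have h2 : (2 : ZMod p) ≠ 0 := by
    intro h
    have h' : ((2 : ℕ) : ZMod p) = 0 := by exact_mod_cast h
    rw [ZMod.natCast_eq_zero_iff] at h'
    exact hpodd ((Nat.prime_dvd_prime_iff_eq hp Nat.prime_two).1 h')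
  have hg : ∀ x, π x = 0 ↔ ∃ y, (p : ZMod (p ^ (t + 2))) * y = x := by
    intro x
    constructor
    · intro hx
      obtain ⟨y, hy⟩ := (hπ x).1 hx
      refine ⟨y, ?_⟩
      rw [← Nat.cast_mul, ← hy, ZMod.natCast_zmod_val]
    · rintro ⟨y, rfl⟩
      rw [map_mul, map_natCast, CharP.cast_eq_zero, zero_mul]
  have hg0 : ∀ a, (p : ZMod (p ^ (t + 2))) * a = 0 → π a = 0 := by
    intro a ha
    rw [ZMod.natCast_mul_eq_zero_iff] at ha
    have hdvd : p * p ∣ p * a.val := (pow_two p ▸ pow_dvd_pow p hr).trans ha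
    exact (hπ a).2 ((Nat.mul_dvd_mul_iff_left hp.pos).1 hdvd)
  have hsum := sum_klSum_sq_pow hloc hψ hϖ hϖ0 h2 hg hg0 (m := m) fun i j hij h =>
    natCast_zmod_inj_of_add_eq_two_mul hp hpodd hpn hij h
  rw [sum_klSum_sq_pow_eq_two_mul hloc hsurj hψ hϖ hϖ0 h2 (by omega), ← S_eq_sum_klSum,
    ZMod.card_units_eq_totient, ZMod.card, Nat.totient_prime_pow_succ hp] at hsum
  have hchoose : (2 * m).choose m = 2 * (2 * m - 1).choose (m - 1) := by
    obtain ⟨l, rfl⟩ : ∃ l, m = l + 1 := ⟨m - 1, by omega⟩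
    rw [show 2 * (l + 1) = l + 1 + l + 1 by ring, Nat.choose_succ_succ' (l + 1 + l) l,
      Nat.choose_symm_add]
    simp [two_mul]
  apply mul_left_cancel₀ (two_ne_zero' ℂ)
  rw [hsum, hchoose]
  have hp0 : (p : ℂ) ≠ 0 := Nat.cast_ne_zero.2 hp.ne_zero
  push_cast [Nat.cast_sub hp.one_le]
  field_simp
  ring
end

section
/- Let n ≥ 2 be an even integer and p a prime with p > max{2, √(n/2)} (equivalently p is odd and 2p² > n). Then for every integer r ≥ 3, S_n(p^r) = C(n−1, n/2 − 1) · ((p−1)/p) · p^{(n/2 + 1)r}; and for r = 2, S_n(p²) = C(n−1, n/2 − 1) · ((p−1)/p) · p^{n+2} − p^{n+1} · Σ* C(n−2, i), where the sum Σ* runs over all integers i with 0 ≤ i ≤ n−2 such that i ≡ n/2 − 1 (mod p) or i ≡ n/2 − 2 (mod p), excluding the two values i = n/2 − 1 and i = n/2 − 2 themselves. Here C(a,b) denotes the binomial coefficient. -/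
open Finset

section PrimePower

open scoped Classical

variable {p r : ℕ} [hp : Fact p.Prime]

lemma natCast_dvd_natCast_iff (hr : r ≠ 0) (m : ℕ) :
    (p : ZMod (p ^ r)) ∣ (m : ZMod (p ^ r)) ↔ p ∣ m := by
  refine ⟨?_, fun h => by exact_mod_cast Nat.cast_dvd_cast (α := ZMod (p ^ r)) h⟩
  rintro ⟨y, hy⟩
  have h := congrArg (ZMod.castHom (dvd_pow_self p hr) (ZMod p)) hy
  rw [map_mul, map_natCast, map_natCast, ZMod.natCast_self, zero_mul] at h
  exact (ZMod.natCast_eq_zero_iff _ _).1 h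

lemma isUnit_iff_not_dvd (hr : r ≠ 0) (x : ZMod (p ^ r)) :
    IsUnit x ↔ ¬ (p : ZMod (p ^ r)) ∣ x := by
  obtain ⟨m, rfl⟩ := ZMod.natCast_zmod_surjective x
  rw [ZMod.isUnit_iff_coprime, natCast_dvd_natCast_iff hr, Nat.coprime_pow_right_iff
    (Nat.pos_of_ne_zero hr), Nat.coprime_comm, hp.out.coprime_iff_not_dvd]

lemma natCast_prime_dvd_mul (hr : r ≠ 0) {x y : ZMod (p ^ r)} :
    (p : ZMod (p ^ r)) ∣ x * y ↔ (p : ZMod (p ^ r)) ∣ x ∨ (p : ZMod (p ^ r)) ∣ y := by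
  have h := (isUnit_iff_not_dvd hr (x * y)).symm.trans
    (IsUnit.mul_iff.trans (and_congr (isUnit_iff_not_dvd hr x) (isUnit_iff_not_dvd hr y)))
  tauto

lemma not_dvd_unit (hr : r ≠ 0) (x : (ZMod (p ^ r))ˣ) : ¬ (p : ZMod (p ^ r)) ∣ x :=
  (isUnit_iff_not_dvd hr _).1 x.isUnit

lemma isUnit_two (hodd : p ≠ 2) : IsUnit (2 : ZMod (p ^ r)) := by
  have h : IsUnit ((2 : ℕ) : ZMod (p ^ r)) := by
    rw [ZMod.isUnit_iff_coprime]
    exact Nat.Coprime.pow_right _ ((Nat.coprime_primes Nat.prime_two hp.out).2 hodd.symm)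
  simpa using h

lemma natCast_pow_mul_eq_zero_iff {s : ℕ} (hs : s ≤ r) (m : ℤ) :
    (p : ZMod (p ^ r)) ^ (r - s) * (m : ZMod (p ^ r)) = 0 ↔ (p : ℤ) ^ s ∣ m := by
  have h : (p : ZMod (p ^ r)) ^ (r - s) * (m : ZMod (p ^ r)) =
      (((p : ℤ) ^ (r - s) * m : ℤ) : ZMod (p ^ r)) := by push_cast; rfl
  have h2 : ((p ^ r : ℕ) : ℤ) = (p : ℤ) ^ (r - s) * (p : ℤ) ^ s := by
    rw [← pow_add, Nat.sub_add_cancel hs]; push_cast; rfl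
  rw [h, ZMod.intCast_zmod_eq_zero_iff_dvd, h2]
  exact mul_dvd_mul_iff_left (pow_ne_zero _ (by exact_mod_cast hp.out.ne_zero))

lemma natCast_pow_mul_eq_zero (hr : r ≠ 0) {x : ZMod (p ^ r)}
    (h : (p : ZMod (p ^ r)) ^ (r - 1) * x = 0) : (p : ZMod (p ^ r)) ∣ x := by
  obtain ⟨m, rfl⟩ := ZMod.natCast_zmod_surjective x
  have := (natCast_pow_mul_eq_zero_iff (p := p) (Nat.one_le_iff_ne_zero.2 hr) (m : ℤ)).1
    (by simpa using h)
  rw [natCast_dvd_natCast_iff hr]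
  exact_mod_cast (by simpa using this : (p : ℤ) ∣ m)

lemma natCast_pow_eq_zero {p r k : ℕ} (hk : r ≤ k) : (p : ZMod (p ^ r)) ^ k = 0 := by
  rw [← Nat.sub_add_cancel hk, pow_add, ← Nat.cast_pow p r, ZMod.natCast_self, mul_zero]

lemma card_dvd (hr : r ≠ 0) :
    #{t : ZMod (p ^ r) | (p : ZMod (p ^ r)) ∣ t} = p ^ (r - 1) := by
  have h1 : #{t : ZMod (p ^ r) | ¬ (p : ZMod (p ^ r)) ∣ t} = p ^ (r - 1) * (p - 1) := by
    rw [← Nat.totient_prime_pow hp.out (Nat.pos_of_ne_zero hr), ← ZMod.card_units_eq_totient,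
      ← Finset.card_univ]
    symm
    refine Finset.card_nbij (fun u => (u : ZMod (p ^ r))) ?_ ?_ ?_
    · intro u _
      simpa using not_dvd_unit hr u
    · exact fun a _ b _ h => Units.ext h
    · intro x hx
      obtain ⟨u, hu⟩ := (isUnit_iff_not_dvd hr x).2 (by simpa using hx)
      exact ⟨u, by simp, hu⟩
  have h2 := Finset.card_filter_add_card_filter_not (s := (univ : Finset (ZMod (p ^ r))))
    (fun t => (p : ZMod (p ^ r)) ∣ t)
  rw [h1, Finset.card_univ, ZMod.card] at h2
  have h3 : p ^ (r - 1) * (p - 1) + p ^ (r - 1) = p ^ r := by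
    rw [← Nat.mul_succ, Nat.succ_eq_add_one, Nat.sub_add_cancel hp.out.one_le, ← pow_succ,
      Nat.sub_add_cancel (Nat.one_le_iff_ne_zero.2 hr)]
  omega

lemma sum_mul_prime {M : Type*} [AddCommMonoid M] (F : ZMod (p ^ r) → M) :
    ∑ x, F (p * x) = #{x : ZMod (p ^ r) | (p : ZMod (p ^ r)) * x = 0} •
      ∑ t with (p : ZMod (p ^ r)) ∣ t, F t := by
  have hsub : ∀ x ∈ (univ : Finset (ZMod (p ^ r))), (p : ZMod (p ^ r)) * x ∈
      ({t | (p : ZMod (p ^ r)) ∣ t} : Finset (ZMod (p ^ r))) := by simp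
  rw [← Finset.sum_fiberwise_of_maps_to' hsub F, Finset.smul_sum]
  refine Finset.sum_congr rfl fun t ht => ?_
  obtain ⟨y, rfl⟩ := (Finset.mem_filter.1 ht).2
  rw [Finset.sum_const]
  congr 1
  refine Finset.card_bij (fun x _ => x - y) ?_ ?_ ?_
  · intro x hx
    simp only [mem_filter, mem_univ, true_and] at hx ⊢
    rw [mul_sub, hx, sub_self]
  · exact fun a _ b _ h => sub_left_injective h
  · intro x hx
    simp only [mem_filter, mem_univ, true_and] at hx
    exact ⟨x + y, by simp [mul_add, hx], by simp⟩

lemma card_ker_mul_card_dvd :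
    #{x : ZMod (p ^ r) | (p : ZMod (p ^ r)) * x = 0} *
      #{t : ZMod (p ^ r) | (p : ZMod (p ^ r)) ∣ t} = p ^ r := by
  have h := sum_mul_prime (p := p) (r := r) (fun _ => 1)
  simpa using h.symm

lemma card_ker (hr : r ≠ 0) :
    #{x : ZMod (p ^ r) | (p : ZMod (p ^ r)) * x = 0} = p := by
  have h := card_ker_mul_card_dvd (p := p) (r := r)
  have h2 : p ^ r = p * p ^ (r - 1) := by
    rw [← pow_succ', Nat.sub_add_cancel (Nat.one_le_iff_ne_zero.2 hr)]
  rw [card_dvd hr] at h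
  replace h := h.trans h2
  exact Nat.eq_of_mul_eq_mul_right (pow_pos hp.out.pos _) h

local notation "ψ" => ZMod.stdAddChar (N := p ^ r)

lemma stdAddChar_eq_one_iff {x : ZMod (p ^ r)} : ψ x = 1 ↔ x = 0 := by
  rw [← AddChar.map_zero_eq_one ψ]
  exact ZMod.injective_stdAddChar.eq_iff

lemma sum_stdAddChar (b : ZMod (p ^ r)) :
    ∑ x, ψ (b * x) = if b = 0 then (p : ℂ) ^ r else 0 := by
  have h := AddChar.sum_mulShift b (ZMod.isPrimitive_stdAddChar (p ^ r))
  simpa [mul_comm b] using h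

lemma sum_stdAddChar_dvd (hr : r ≠ 0) (b : ZMod (p ^ r)) :
    ∑ t with (p : ZMod (p ^ r)) ∣ t, ψ (b * t) =
      if (p : ZMod (p ^ r)) * b = 0 then (p : ℂ) ^ (r - 1) else 0 := by
  have h := sum_mul_prime (p := p) (r := r) (fun t => ψ (b * t))
  rw [card_ker hr, nsmul_eq_mul] at h
  have hp0 : (p : ℂ) ≠ 0 := by exact_mod_cast hp.out.ne_zero
  have h2 : ∑ x, ψ (b * (p * x)) = if (p : ZMod (p ^ r)) * b = 0 then (p : ℂ) ^ r else 0 := by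
    rw [← sum_stdAddChar]
    exact Finset.sum_congr rfl fun x _ => by ring_nf
  rw [h2] at h
  apply mul_left_cancel₀ hp0
  rw [← h]
  split_ifs
  · rw [← pow_succ', Nat.sub_add_cancel (Nat.one_le_iff_ne_zero.2 hr)]
  · simp

variable (p r) in
/-- The Kloosterman sum modulo `p ^ r` with second argument `1`. -/
noncomputable def unitKl (u : ZMod (p ^ r)) : ℂ :=
  ∑ x : (ZMod (p ^ r))ˣ, ψ (u * x + (x⁻¹ : (ZMod (p ^ r))ˣ))

variable (p r) in
/-- The normalised contribution to `unitKl` of the neighbourhood of a stationary point. -/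
noncomputable def localSum (a : ZMod (p ^ r)) : ℂ :=
  ∑ y : (ZMod (p ^ r))ˣ with (p : ZMod (p ^ r)) ∣ (y : (ZMod (p ^ r))ˣ) - 1,
    ψ (a * ((y - 1) ^ 2 * (y⁻¹ : (ZMod (p ^ r))ˣ)))

lemma sum_nonstationary (hr : 2 ≤ r) (u : ZMod (p ^ r)) :
    ∑ x : (ZMod (p ^ r))ˣ with ¬ (p : ZMod (p ^ r)) ∣ u * x - (x⁻¹ : (ZMod (p ^ r))ˣ),
      ψ (u * x + (x⁻¹ : (ZMod (p ^ r))ˣ)) = 0 := by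
  obtain ⟨c, hc, hcc⟩ : ∃ c : ZMod (p ^ r), c = (p : ZMod (p ^ r)) ^ (r - 1) ∧ c * c = 0 :=
    ⟨_, rfl, by rw [← pow_add]; exact natCast_pow_eq_zero (by omega)⟩
  have hpc : (p : ZMod (p ^ r)) ∣ c := hc ▸ dvd_pow_self _ (by omega)
  let g : (ZMod (p ^ r))ˣ :=
    ⟨1 + c, 1 - c, by linear_combination -hcc, by linear_combination -hcc⟩
  have hg : (g : ZMod (p ^ r)) = 1 + c := rfl
  have hg' : ((g⁻¹ : (ZMod (p ^ r))ˣ) : ZMod (p ^ r)) = 1 - c := rfl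
  let f : (ZMod (p ^ r))ˣ → ℂ := fun x => ψ (u * x + (x⁻¹ : (ZMod (p ^ r))ˣ))
  let ζ : (ZMod (p ^ r))ˣ → ℂ := fun x => ψ (c * (u * x - (x⁻¹ : (ZMod (p ^ r))ˣ)))
  have hf : ∀ x, f (x * g) = f x * ζ x := by
    intro x
    simp only [f, ζ]
    rw [← AddChar.map_add_eq_mul, mul_inv, Units.val_mul, Units.val_mul, hg, hg']
    ring_nf
  have hζ : ∀ x, ζ (x * g) = ζ x := by
    intro x
    simp only [ζ]
    rw [mul_inv, Units.val_mul, Units.val_mul, hg, hg']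
    congr 1
    linear_combination (u * x + (x⁻¹ : (ZMod (p ^ r))ˣ)) * hcc
  let h : (ZMod (p ^ r))ˣ → ℂ := fun x => f x / (1 - ζ x)
  have hh : ∀ x : (ZMod (p ^ r))ˣ, ¬ (p : ZMod (p ^ r)) ∣ u * x - (x⁻¹ : (ZMod (p ^ r))ˣ) →
      f x = h x - h (x * g) := by
    intro x hx
    have hne : 1 - ζ x ≠ 0 := by
      intro h0
      have h1 : ψ (c * (u * x - (x⁻¹ : (ZMod (p ^ r))ˣ))) = 1 := (sub_eq_zero.1 h0).symm
      rw [stdAddChar_eq_one_iff, hc] at h1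
      exact hx (natCast_pow_mul_eq_zero (by omega) h1)
    simp only [h, hζ, hf]
    field_simp
  have hinv : ∀ x : (ZMod (p ^ r))ˣ,
      ((p : ZMod (p ^ r)) ∣ u * (x * g : (ZMod (p ^ r))ˣ) - ((x * g)⁻¹ : (ZMod (p ^ r))ˣ)) ↔
      (p : ZMod (p ^ r)) ∣ u * x - (x⁻¹ : (ZMod (p ^ r))ˣ) := by
    intro x
    rw [mul_inv, Units.val_mul, Units.val_mul, hg, hg']
    have : u * (x * (1 + c)) - (x⁻¹ : (ZMod (p ^ r))ˣ) * (1 - c) =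
      (u * x - (x⁻¹ : (ZMod (p ^ r))ˣ)) + c * (u * x + (x⁻¹ : (ZMod (p ^ r))ˣ)) := by ring
    rw [this]
    exact (dvd_add_left (hpc.mul_right _))
  rw [Finset.sum_congr rfl fun x hx => hh x (Finset.mem_filter.1 hx).2, Finset.sum_sub_distrib,
    sub_eq_zero, Finset.sum_filter, Finset.sum_filter, ← Equiv.sum_comp (Equiv.mulRight g)]
  refine Finset.sum_congr rfl fun x _ => ?_
  simp only [Equiv.coe_mulRight, hinv]

lemma sum_stationary (a : (ZMod (p ^ r))ˣ) :
    ∑ x : (ZMod (p ^ r))ˣ with (p : ZMod (p ^ r)) ∣ a * (x : (ZMod (p ^ r))ˣ) - 1,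
      ψ (a ^ 2 * x + (x⁻¹ : (ZMod (p ^ r))ˣ)) = ψ (2 * a) * localSum p r a := by
  rw [localSum, Finset.mul_sum, Finset.sum_filter, Finset.sum_filter,
    eq_comm, ← Equiv.sum_comp (Equiv.mulLeft a)]
  refine Finset.sum_congr rfl fun x _ => ?_
  simp only [Equiv.coe_mulLeft, Units.val_mul]
  congr 1
  rw [← AddChar.map_add_eq_mul, mul_inv, Units.val_mul]
  congr 1
  linear_combination (((a : ZMod (p ^ r)) ^ 2 * x - 2 * a) * (x * (x⁻¹ : (ZMod (p ^ r))ˣ))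
    + (x⁻¹ : (ZMod (p ^ r))ˣ)) * a.mul_inv +
    ((a : ZMod (p ^ r)) ^ 2 * x - 2 * a) * x.mul_inv

lemma unitKl_sq (hr : 2 ≤ r) (hodd : p ≠ 2) (a : (ZMod (p ^ r))ˣ) :
    unitKl p r (a ^ 2) = ψ (2 * a) * localSum p r a + ψ (-(2 * a)) * localSum p r (-a) := by
  have h2 : ψ (-(2 * a)) * localSum p r (-a) =
      ∑ x : (ZMod (p ^ r))ˣ with (p : ZMod (p ^ r)) ∣ a * (x : (ZMod (p ^ r))ˣ) + 1,
        ψ (a ^ 2 * x + (x⁻¹ : (ZMod (p ^ r))ˣ)) := by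
    have h := sum_stationary (-a)
    simp only [Units.val_neg, neg_sq, mul_neg, neg_mul] at h
    rw [← h]
    refine Finset.sum_congr (Finset.filter_congr fun x _ => ?_) fun _ _ => rfl
    rw [← neg_add', dvd_neg]
  rw [h2, ← sum_stationary, unitKl, ← Finset.sum_filter_not_add_sum_filter univ
    (fun x : (ZMod (p ^ r))ˣ => (p : ZMod (p ^ r)) ∣ a ^ 2 * x - (x⁻¹ : (ZMod (p ^ r))ˣ)),
    sum_nonstationary hr, zero_add, ← Finset.sum_union]
  · refine Finset.sum_congr ?_ fun _ _ => rfl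
    ext x
    simp only [mem_filter, mem_univ, true_and, mem_union]
    rw [← natCast_prime_dvd_mul (by omega)]
    have : (a : ZMod (p ^ r)) ^ 2 * x - (x⁻¹ : (ZMod (p ^ r))ˣ) =
        (x⁻¹ : (ZMod (p ^ r))ˣ) * ((a * x - 1) * (a * x + 1)) := by
      linear_combination -(a : ZMod (p ^ r)) ^ 2 * x * x.mul_inv
    rw [this, natCast_prime_dvd_mul (by omega)]
    simp [not_dvd_unit (show r ≠ 0 by omega) x⁻¹]
  · rw [Finset.disjoint_filter]
    intro x _ h1 h3
    have h4 := dvd_sub h3 h1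
    rw [show (a : ZMod (p ^ r)) * x + 1 - (a * x - 1) = 2 by ring] at h4
    exact (isUnit_iff_not_dvd (by omega) _).1 (isUnit_two hodd) h4

lemma localSum_add (hr : 2 ≤ r) (a b : ZMod (p ^ r)) :
    localSum p r (a + (p : ZMod (p ^ r)) ^ (r - 2) * b) = localSum p r a := by
  refine Finset.sum_congr rfl fun y hy => ?_
  obtain ⟨t, ht⟩ := (Finset.mem_filter.1 hy).2
  have h0 : (p : ZMod (p ^ r)) ^ (r - 2) * (p : ZMod (p ^ r)) ^ 2 = 0 := by
    rw [← pow_add]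
    exact natCast_pow_eq_zero (by omega)
  rw [ht]
  congr 1
  linear_combination b * t ^ 2 * (y⁻¹ : (ZMod (p ^ r))ˣ) * h0

lemma sum_one_units (hr : r ≠ 0) {M : Type*} [AddCommMonoid M] (F : ZMod (p ^ r) → M) :
    ∑ y : (ZMod (p ^ r))ˣ with (p : ZMod (p ^ r)) ∣ (y : (ZMod (p ^ r))ˣ) - 1, F (y - 1) =
      ∑ t with (p : ZMod (p ^ r)) ∣ t, F t := by
  refine Finset.sum_nbij (fun y => (y : ZMod (p ^ r)) - 1) ?_ ?_ ?_ fun _ _ => rfl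
  · intro y hy
    simpa using hy
  · exact fun a _ b _ h => Units.ext (sub_left_injective h)
  · intro t ht
    have ht' : (p : ZMod (p ^ r)) ∣ t := by simpa using ht
    have hu : IsUnit (t + 1) := by
      rw [isUnit_iff_not_dvd hr]
      intro h
      rw [dvd_add_right ht'] at h
      exact (isUnit_iff_not_dvd hr _).1 isUnit_one h
    obtain ⟨u, hu⟩ := hu
    exact ⟨u, by simp [hu, ht'], by simp [hu]⟩

lemma card_one_units (hr : r ≠ 0) :
    #{y : (ZMod (p ^ r))ˣ | (p : ZMod (p ^ r)) ∣ (y : (ZMod (p ^ r))ˣ) - 1} = p ^ (r - 1) := by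
  have h := sum_one_units (p := p) hr (fun _ => 1)
  rwa [← Finset.card_eq_sum_ones, ← Finset.card_eq_sum_ones, card_dvd hr] at h

lemma sum_sub_inv_s18 (hr : r ≠ 0) (hodd : p ≠ 2) {w : (ZMod (p ^ r))ˣ}
    (hw : (p : ZMod (p ^ r)) ∣ w - 1) (F : ZMod (p ^ r) → ℂ) :
    ∑ z : (ZMod (p ^ r))ˣ with (p : ZMod (p ^ r)) ∣ (z : (ZMod (p ^ r))ˣ) - 1,
      F (z - ((z * w)⁻¹ : (ZMod (p ^ r))ˣ)) = ∑ t with (p : ZMod (p ^ r)) ∣ t, F t := by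
  have hmul : ∀ z : (ZMod (p ^ r))ˣ, (p : ZMod (p ^ r)) ∣ z - 1 →
      ∀ v : (ZMod (p ^ r))ˣ, (p : ZMod (p ^ r)) ∣ v - 1 →
      (p : ZMod (p ^ r)) ∣ (z * v : (ZMod (p ^ r))ˣ) - 1 := by
    intro z hz v hv
    rw [Units.val_mul, show (z : ZMod (p ^ r)) * v - 1 = z * (v - 1) + (z - 1) by ring]
    exact dvd_add (hv.mul_left _) hz
  have hinv : ∀ z : (ZMod (p ^ r))ˣ, (p : ZMod (p ^ r)) ∣ z - 1 →
      (p : ZMod (p ^ r)) ∣ (z⁻¹ : (ZMod (p ^ r))ˣ) - 1 := by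
    intro z hz
    rw [show ((z⁻¹ : (ZMod (p ^ r))ˣ) : ZMod (p ^ r)) - 1 =
      -((z⁻¹ : (ZMod (p ^ r))ˣ) * (z - 1)) by linear_combination z.mul_inv, dvd_neg]
    exact hz.mul_left _
  have hmaps : ∀ z ∈ ({z : (ZMod (p ^ r))ˣ | (p : ZMod (p ^ r)) ∣ (z : (ZMod (p ^ r))ˣ) - 1} :
      Finset _), (z : ZMod (p ^ r)) - ((z * w)⁻¹ : (ZMod (p ^ r))ˣ) ∈
      ({t | (p : ZMod (p ^ r)) ∣ t} : Finset (ZMod (p ^ r))) := by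
    intro z hz
    rw [Finset.mem_filter] at hz ⊢
    refine ⟨mem_univ _, ?_⟩
    have := dvd_sub hz.2 (hinv _ (hmul _ hz.2 _ hw))
    rwa [sub_sub_sub_cancel_right] at this
  have hinj : Set.InjOn (fun z : (ZMod (p ^ r))ˣ =>
      (z : ZMod (p ^ r)) - ((z * w)⁻¹ : (ZMod (p ^ r))ˣ))
      ({z : (ZMod (p ^ r))ˣ | (p : ZMod (p ^ r)) ∣ (z : (ZMod (p ^ r))ˣ) - 1} : Finset _) := by
    intro z hz v hv hzv
    have hz' : (p : ZMod (p ^ r)) ∣ z - 1 := by simpa using hz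
    have hv' : (p : ZMod (p ^ r)) ∣ v - 1 := by simpa using hv
    have hk : (p : ZMod (p ^ r)) ∣ (z⁻¹ * (v * w)⁻¹ : (ZMod (p ^ r))ˣ) - 1 :=
      hmul _ (hinv _ hz') _ (hinv _ (hmul _ hv' _ hw))
    have hunit : IsUnit (((z⁻¹ * (v * w)⁻¹ : (ZMod (p ^ r))ˣ) : ZMod (p ^ r)) + 1) := by
      rw [isUnit_iff_not_dvd hr]
      intro h
      have h4 := dvd_sub h hk
      rw [add_sub_sub_cancel, one_add_one_eq_two] at h4
      exact (isUnit_iff_not_dvd hr _).1 (isUnit_two hodd) h4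
    have hprod : ((z : ZMod (p ^ r)) - v) *
        (((z⁻¹ * (v * w)⁻¹ : (ZMod (p ^ r))ˣ) : ZMod (p ^ r)) + 1) = 0 := by
      simp only [mul_inv, Units.val_mul] at hzv ⊢
      linear_combination hzv + (v⁻¹ : (ZMod (p ^ r))ˣ) * (w⁻¹ : (ZMod (p ^ r))ˣ) * z.mul_inv
        - (z⁻¹ : (ZMod (p ^ r))ˣ) * (w⁻¹ : (ZMod (p ^ r))ˣ) * v.mul_inv
    exact Units.ext (sub_eq_zero.1 (hunit.mul_left_eq_zero.1 hprod))
  refine Finset.sum_nbij _ hmaps hinj ?_ fun _ _ => rfl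
  exact Finset.surjOn_of_injOn_of_card_le _ hmaps hinj
    (by rw [card_one_units hr, card_dvd hr])

lemma localSum_mul_neg (hr : 2 ≤ r) (hodd : p ≠ 2) (a : (ZMod (p ^ r))ˣ) :
    localSum p r a * localSum p r (-a) = (p : ℂ) ^ r := by
  have hr0 : r ≠ 0 := by omega
  have h1 : localSum p r a * localSum p r (-a) =
      ∑ z : (ZMod (p ^ r))ˣ with (p : ZMod (p ^ r)) ∣ (z : (ZMod (p ^ r))ˣ) - 1,
      ∑ w : (ZMod (p ^ r))ˣ with (p : ZMod (p ^ r)) ∣ (w : (ZMod (p ^ r))ˣ) - 1,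
        ψ (a * (w - 1) * (z - ((z * w)⁻¹ : (ZMod (p ^ r))ˣ))) := by
    rw [mul_comm, localSum, Finset.sum_mul]
    refine Finset.sum_congr rfl fun z hz => ?_
    have hz' := (Finset.mem_filter.1 hz).2
    rw [localSum, Finset.mul_sum, Finset.sum_filter, Finset.sum_filter,
      ← Equiv.sum_comp (Equiv.mulLeft z)]
    refine Finset.sum_congr rfl fun w _ => ?_
    have hiff : (p : ZMod (p ^ r)) ∣ (z * w : (ZMod (p ^ r))ˣ) - 1 ↔
        (p : ZMod (p ^ r)) ∣ w - 1 := by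
      rw [Units.val_mul, show (z : ZMod (p ^ r)) * w - 1 = z * (w - 1) + (z - 1) by ring,
        dvd_add_left hz', Units.dvd_mul_left]
    simp only [Equiv.coe_mulLeft, hiff]
    congr 1
    rw [← AddChar.map_add_eq_mul]
    congr 1
    simp only [mul_inv, Units.val_mul]
    linear_combination (a : ZMod (p ^ r)) * (2 - z + (z * w - 2) * (w * (w⁻¹ : (ZMod (p ^ r))ˣ))) *
      z.mul_inv + a * (z * w - 2 + (z⁻¹ : (ZMod (p ^ r))ˣ)) * w.mul_inv
  have h2 : ∀ w : (ZMod (p ^ r))ˣ, (p : ZMod (p ^ r)) ∣ w - 1 →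
      ∑ z : (ZMod (p ^ r))ˣ with (p : ZMod (p ^ r)) ∣ (z : (ZMod (p ^ r))ˣ) - 1,
        ψ (a * (w - 1) * (z - ((z * w)⁻¹ : (ZMod (p ^ r))ˣ))) =
      if (p : ZMod (p ^ r)) * (w - 1) = 0 then (p : ℂ) ^ (r - 1) else 0 := by
    intro w hw
    rw [sum_sub_inv_s18 hr0 hodd hw (fun t => ψ (a * (w - 1) * t)), sum_stdAddChar_dvd hr0]
    simp only [mul_left_comm _ (a : ZMod (p ^ r)), Units.mul_right_eq_zero]
  rw [h1, Finset.sum_comm, Finset.sum_congr rfl fun w hw => h2 w (Finset.mem_filter.1 hw).2,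
    sum_one_units hr0 (fun t => if (p : ZMod (p ^ r)) * t = 0 then (p : ℂ) ^ (r - 1) else 0),
    ← Finset.sum_filter, Finset.filter_filter]
  have hker : ({t | (p : ZMod (p ^ r)) ∣ t ∧ (p : ZMod (p ^ r)) * t = 0} :
      Finset (ZMod (p ^ r))) = ({t | (p : ZMod (p ^ r)) * t = 0} : Finset (ZMod (p ^ r))) := by
    refine Finset.filter_congr fun t _ => and_iff_right_of_imp fun h => ?_
    refine natCast_pow_mul_eq_zero hr0 ?_
    rw [show r - 1 = r - 2 + 1 by omega, pow_succ, mul_assoc, h, mul_zero]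
  rw [hker, Finset.sum_const, card_ker hr0, nsmul_eq_mul, ← pow_succ',
    Nat.sub_add_cancel (by omega)]

lemma exists_sq_of_unitKl_ne_zero (hr : 2 ≤ r) (hodd : p ≠ 2) {u : ZMod (p ^ r)}
    (hu : unitKl p r u ≠ 0) : ∃ a : (ZMod (p ^ r))ˣ, (a : ZMod (p ^ r)) ^ 2 = u := by
  obtain ⟨x, hx⟩ : ∃ x : (ZMod (p ^ r))ˣ,
      (p : ZMod (p ^ r)) ∣ u * x - (x⁻¹ : (ZMod (p ^ r))ˣ) := by
    by_contra! h
    refine hu ?_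
    rw [unitKl, ← sum_nonstationary hr u]
    simp [h]
  have hv : (p : ZMod (p ^ r)) ∣ u * x ^ 2 - 1 := by
    have : u * (x : ZMod (p ^ r)) ^ 2 - 1 = x * (u * x - (x⁻¹ : (ZMod (p ^ r))ˣ)) := by
      linear_combination x.mul_inv
    rw [this]
    exact hx.mul_left _
  have hpow := dvd_sub_pow_of_dvd_sub hv (r - 1)
  rw [Nat.sub_add_cancel (by omega), natCast_pow_eq_zero le_rfl, zero_dvd_iff, one_pow,
    sub_eq_zero] at hpow
  obtain ⟨k, hk⟩ : Odd (p ^ (r - 1)) := (hp.out.odd_of_ne_two hodd).pow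
  rw [hk] at hpow
  obtain ⟨v, hv'⟩ : IsUnit (u * (x : ZMod (p ^ r)) ^ 2) := IsUnit.of_pow_eq_one hpow (by omega)
  rw [← hv'] at hpow
  refine ⟨v ^ (k + 1) * x⁻¹, ?_⟩
  push_cast
  have : ((v : ZMod (p ^ r)) ^ (k + 1) * (x⁻¹ : (ZMod (p ^ r))ˣ)) ^ 2 =
      (v : ZMod (p ^ r)) ^ (2 * k + 1) * v * (x⁻¹ : (ZMod (p ^ r))ˣ) ^ 2 := by ring
  rw [this, hpow, hv']
  linear_combination (u * (x * (x⁻¹ : (ZMod (p ^ r))ˣ) + 1)) * x.mul_inv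

lemma card_sqrt (hr : r ≠ 0) (hodd : p ≠ 2) (a : (ZMod (p ^ r))ˣ) :
    #{b : (ZMod (p ^ r))ˣ | ((b : (ZMod (p ^ r))ˣ) : ZMod (p ^ r)) ^ 2 = a ^ 2} = 2 := by
  have h2 := (isUnit_iff_not_dvd hr _).1 (isUnit_two (p := p) (r := r) hodd)
  have hset : ({b : (ZMod (p ^ r))ˣ | ((b : (ZMod (p ^ r))ˣ) : ZMod (p ^ r)) ^ 2 = a ^ 2} :
      Finset (ZMod (p ^ r))ˣ) = {a, -a} := by
    ext b
    simp only [mem_filter, mem_univ, true_and, mem_insert, mem_singleton]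
    constructor
    · intro h
      have hmul : ((b : ZMod (p ^ r)) - a) * (b + a) = 0 := by linear_combination h
      by_cases hb : (p : ZMod (p ^ r)) ∣ b - a
      · left
        have hu : IsUnit ((b : ZMod (p ^ r)) + a) := by
          rw [isUnit_iff_not_dvd hr]
          intro h'
          have h3 := dvd_sub h' hb
          rw [add_sub_sub_cancel, ← two_mul, natCast_prime_dvd_mul hr] at h3
          exact h3.elim h2 (not_dvd_unit hr a)
        exact Units.ext (sub_eq_zero.1 (hu.mul_left_eq_zero.1 hmul))
      · right
        have hu := (isUnit_iff_not_dvd hr _).2 hb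
        exact Units.ext (by simpa using eq_neg_of_add_eq_zero_left (hu.mul_right_eq_zero.1 hmul))
    · rintro (rfl | rfl) <;> simp
  rw [hset, Finset.card_pair]
  intro h
  have h3 : (2 : ZMod (p ^ r)) * a = 0 := by
    have := congrArg (Units.val) h
    rw [Units.val_neg] at this
    linear_combination this
  have h4 : (p : ZMod (p ^ r)) ∣ 2 * a := h3 ▸ dvd_zero _
  exact ((natCast_prime_dvd_mul hr).1 h4).elim h2 (not_dvd_unit hr a)

lemma two_mul_sum_unitKl_pow (hr : 2 ≤ r) (hodd : p ≠ 2) {n : ℕ} (hn : n ≠ 0) :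
    2 * ∑ u, unitKl p r u ^ n = ∑ a : (ZMod (p ^ r))ˣ, unitKl p r (a ^ 2) ^ n := by
  rw [← Finset.sum_fiberwise' univ (fun a : (ZMod (p ^ r))ˣ => (a : ZMod (p ^ r)) ^ 2)
    (fun u => unitKl p r u ^ n), Finset.mul_sum]
  refine Finset.sum_congr rfl fun u _ => ?_
  rw [Finset.sum_const, nsmul_eq_mul]
  by_cases hu : unitKl p r u = 0
  · simp [hu, hn]
  · obtain ⟨a, rfl⟩ := exists_sq_of_unitKl_ne_zero hr hodd hu
    rw [card_sqrt (by omega) hodd, Nat.cast_ofNat]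

lemma sum_units_eq (hr : r ≠ 0) (F : ZMod (p ^ r) → ℂ) :
    ∑ a : (ZMod (p ^ r))ˣ, F a = ∑ t with ¬ (p : ZMod (p ^ r)) ∣ t, F t := by
  refine Finset.sum_nbij (fun a => (a : ZMod (p ^ r))) ?_ ?_ ?_ fun _ _ => rfl
  · intro a _
    simpa using not_dvd_unit hr a
  · exact fun a _ b _ h => Units.ext h
  · intro t ht
    obtain ⟨u, hu⟩ := (isUnit_iff_not_dvd hr t).2 (by simpa using ht)
    exact ⟨u, by simp, hu⟩

lemma unitKl_sq_pow (hr : 2 ≤ r) (hodd : p ≠ 2) (h : ℕ) (a : (ZMod (p ^ r))ˣ) :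
    unitKl p r (a ^ 2) ^ (2 * h) = ∑ j ∈ range (2 * h + 1), ((2 * h).choose j : ℂ) *
      (ψ (((4 * (j - h) : ℤ) : ZMod (p ^ r)) * a) *
        (localSum p r a ^ j * localSum p r (-a) ^ (2 * h - j))) := by
  rw [unitKl_sq hr hodd, add_pow]
  refine Finset.sum_congr rfl fun j hj => ?_
  have hj' : j ≤ 2 * h := Nat.lt_succ_iff.1 (Finset.mem_range.1 hj)
  have hψ : ψ (((4 * (j - h) : ℤ) : ZMod (p ^ r)) * a) =
      ψ (2 * a) ^ j * ψ (-(2 * a)) ^ (2 * h - j) := by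
    rw [← AddChar.map_nsmul_eq_pow, ← AddChar.map_nsmul_eq_pow, ← AddChar.map_add_eq_mul]
    congr 1
    rw [nsmul_eq_mul, nsmul_eq_mul, Nat.cast_sub hj']
    push_cast
    ring
  rw [hψ, mul_pow, mul_pow]
  ring

lemma natCast_pow_mul_four_mul_eq_zero_iff {s : ℕ} (hs : s ≤ r) (hodd : p ≠ 2) (m : ℤ) :
    (p : ZMod (p ^ r)) ^ (r - s) * ((4 * m : ℤ) : ZMod (p ^ r)) = 0 ↔ (p : ℤ) ^ s ∣ m := by
  rw [natCast_pow_mul_eq_zero_iff hs]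
  refine ⟨IsCoprime.dvd_of_dvd_mul_left (IsCoprime.pow_left ?_), fun hd => hd.mul_left _⟩
  have : Nat.Coprime p 4 := by
    rw [show 4 = 2 ^ 2 by rfl]
    exact Nat.Coprime.pow_right _ ((Nat.coprime_primes hp.out Nat.prime_two).2 hodd)
  exact_mod_cast Nat.isCoprime_iff_coprime.2 this

lemma sum_unitKl_sq_pow_of_three_le (hr : 3 ≤ r) (hodd : p ≠ 2) {h : ℕ} (hh : h < p ^ 2) :
    ∑ a : (ZMod (p ^ r))ˣ, unitKl p r (a ^ 2) ^ (2 * h) =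
      (2 * h).choose h * ((p : ℂ) ^ (r - 1) * (p - 1) * (p : ℂ) ^ (r * h)) := by
  have hr0 : r ≠ 0 := by omega
  rw [Finset.sum_congr rfl fun a _ => unitKl_sq_pow (by omega) hodd h a, Finset.sum_comm,
    Finset.sum_eq_single_of_mem h (by simp; omega)]
  · have hterm : ∀ a : (ZMod (p ^ r))ˣ, ψ (((4 * (h - h : ℤ) : ℤ) : ZMod (p ^ r)) * a) *
        (localSum p r a ^ h * localSum p r (-a) ^ (2 * h - h)) = (p : ℂ) ^ (r * h) := by
      intro a
      rw [show 2 * h - h = h by omega, ← mul_pow, localSum_mul_neg (by omega) hodd, pow_mul]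
      simp
    rw [← Finset.mul_sum, Finset.sum_congr rfl fun a _ => hterm a, Finset.sum_const,
      Finset.card_univ, ZMod.card_units_eq_totient, Nat.totient_prime_pow hp.out (by omega),
      nsmul_eq_mul]
    push_cast [Nat.cast_sub hp.out.one_le]
    ring
  · intro j hj hjh
    rw [← Finset.mul_sum]
    refine mul_eq_zero_of_right _ ?_
    let b : ZMod (p ^ r) := ((4 * (j - h) : ℤ) : ZMod (p ^ r))
    let c : ZMod (p ^ r) := (p : ZMod (p ^ r)) ^ (r - 2)
    have hadd : ∀ t, localSum p r (t + c) = localSum p r t := by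
      intro t
      have := localSum_add (p := p) (r := r) (by omega) t 1
      rwa [mul_one] at this
    have hadd' : ∀ t, localSum p r (-(t + c)) = localSum p r (-t) := by
      intro t
      rw [← hadd (-(t + c)), neg_add, neg_add_cancel_right]
    let T := ∑ t with ¬ (p : ZMod (p ^ r)) ∣ t,
      ψ (b * t) * (localSum p r t ^ j * localSum p r (-t) ^ (2 * h - j))
    have hT : T = ψ (b * c) * T := by
      simp only [T]
      rw [Finset.mul_sum, Finset.sum_filter, Finset.sum_filter,
        ← Equiv.sum_comp (Equiv.addRight c)]
      refine Finset.sum_congr rfl fun t _ => ?_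
      have hdvd : (p : ZMod (p ^ r)) ∣ t + c ↔ (p : ZMod (p ^ r)) ∣ t :=
        dvd_add_left (dvd_pow_self _ (by omega))
      simp only [Equiv.coe_addRight, hdvd, hadd, hadd', mul_add, AddChar.map_add_eq_mul]
      congr 1
      ring
    have hne : ψ (b * c) ≠ 1 := by
      rw [Ne, stdAddChar_eq_one_iff, mul_comm,
        natCast_pow_mul_four_mul_eq_zero_iff (by omega) hodd]
      intro hd
      have hj' := Finset.mem_range.1 hj
      refine hjh ?_
      have h0 := Int.eq_zero_of_abs_lt_dvd hd (by
        have : (h : ℤ) < (p : ℤ) ^ 2 := by exact_mod_cast hh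
        rw [abs_lt]
        omega)
      omega
    rw [sum_units_eq hr0 (fun t => ψ (b * t) *
      (localSum p r t ^ j * localSum p r (-t) ^ (2 * h - j)))]
    change T = 0
    have : (1 - ψ (b * c)) * T = 0 := by linear_combination hT
    exact (mul_eq_zero.1 this).resolve_left (sub_ne_zero.2 hne.symm)

lemma localSum_of_eq_two (hr : r = 2) (a : ZMod (p ^ r)) : localSum p r a = p := by
  have hterm : ∀ y : (ZMod (p ^ r))ˣ, (p : ZMod (p ^ r)) ∣ y - 1 →
      ψ (a * (((y : ZMod (p ^ r)) - 1) ^ 2 * (y⁻¹ : (ZMod (p ^ r))ˣ))) = 1 := by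
    rintro y ⟨t, ht⟩
    rw [ht, mul_pow, natCast_pow_eq_zero hr.le]
    simp
  rw [localSum, Finset.sum_congr rfl fun y hy => hterm y (Finset.mem_filter.1 hy).2,
    Finset.sum_const, card_one_units (show r ≠ 0 by omega), show r - 1 = 1 by omega]
  simp

lemma sum_unitKl_sq_pow_of_eq_two (hr : r = 2) (hodd : p ≠ 2) {h : ℕ} (hh : h < p ^ 2) :
    ∑ a : (ZMod (p ^ r))ˣ, unitKl p r (a ^ 2) ^ (2 * h) =
      (2 * h).choose h * ((p : ℂ) * (p - 1) * (p : ℂ) ^ (2 * h)) -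
      (p : ℂ) ^ (2 * h + 1) * ∑ j ∈ range (2 * h + 1) with
        (j ≠ h ∧ (p : ℤ) ∣ (j : ℤ) - h), ((2 * h).choose j : ℂ) := by
  have hterm : ∀ j ∈ range (2 * h + 1), ∑ a : (ZMod (p ^ r))ˣ, ((2 * h).choose j : ℂ) *
      (ψ (((4 * (j - h) : ℤ) : ZMod (p ^ r)) * a) *
        (localSum p r a ^ j * localSum p r (-a) ^ (2 * h - j))) =
      (if j = h then (2 * h).choose j * ((p : ℂ) * (p - 1) * (p : ℂ) ^ (2 * h)) else 0) -
      (p : ℂ) ^ (2 * h + 1) * (if j ≠ h ∧ (p : ℤ) ∣ (j : ℤ) - h then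
        ((2 * h).choose j : ℂ) else 0) := by
    intro j hj
    have hj' := Finset.mem_range.1 hj
    simp only [localSum_of_eq_two hr, ← pow_add, show j + (2 * h - j) = 2 * h by omega]
    have hall := sum_stdAddChar (p := p) (r := r) ((4 * (j - h) : ℤ) : ZMod (p ^ r))
    have hdvd := sum_stdAddChar_dvd (p := p) (r := r) (by omega)
      ((4 * (j - h) : ℤ) : ZMod (p ^ r))
    have hz : ((4 * (j - h) : ℤ) : ZMod (p ^ r)) = 0 ↔ j = h := by
      have := natCast_pow_mul_four_mul_eq_zero_iff (p := p) hr.ge hodd (j - h)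
      rw [show r - 2 = 0 by omega, pow_zero, one_mul] at this
      rw [this]
      constructor
      · intro hd
        have h0 := Int.eq_zero_of_abs_lt_dvd hd (by
          have : (h : ℤ) < (p : ℤ) ^ 2 := by exact_mod_cast hh
          rw [abs_lt]
          omega)
        omega
      · rintro rfl
        simp
    have hz' : (p : ZMod (p ^ r)) * ((4 * (j - h) : ℤ) : ZMod (p ^ r)) = 0 ↔
        (p : ℤ) ∣ (j : ℤ) - h := by
      have := natCast_pow_mul_four_mul_eq_zero_iff (p := p) (show 1 ≤ r by omega) hodd (j - h)
      rwa [pow_one, show r - 1 = 1 by omega, pow_one] at this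
    simp only [hz] at hall
    simp only [hz', show r - 1 = 1 by omega, pow_one] at hdvd
    rw [← Finset.mul_sum, ← Finset.sum_mul, sum_units_eq (show r ≠ 0 by omega)
      (fun t => ψ (((4 * (j - h) : ℤ) : ZMod (p ^ r)) * t))]
    rw [← Finset.sum_filter_add_sum_filter_not univ (fun t => (p : ZMod (p ^ r)) ∣ t), hdvd] at hall
    rw [← eq_sub_iff_add_eq'] at hall
    rw [hall, show (p : ℂ) ^ r = p ^ 2 by rw [hr]]
    by_cases hjh : j = h
    · subst hjh
      simp only [sub_self, dvd_zero, if_true, ne_eq, not_true_eq_false, false_and, if_false]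
      ring
    · simp only [hjh, ne_eq, not_false_eq_true, true_and, if_false]
      split_ifs <;> ring
  rw [Finset.sum_congr rfl fun a _ => unitKl_sq_pow hr.ge hodd h a, Finset.sum_comm,
    Finset.sum_congr rfl hterm, Finset.sum_sub_distrib, ← Finset.mul_sum, ← Finset.sum_filter,
    ← Finset.sum_filter, Finset.filter_eq', if_pos (by simp; omega), Finset.sum_singleton]

lemma Kl_eq_unitKl (u : ℤ) : Kl (p ^ r) u 1 = unitKl p r u := by
  rw [Kl, unitKl, ← Finset.sum_filter]
  symm
  refine Finset.sum_nbij (fun x => (x : ZMod (p ^ r)).val) ?_ ?_ ?_ ?_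
  · intro x _
    simpa [ZMod.val_lt] using ZMod.val_coe_unit_coprime x
  · exact fun x _ y _ h => Units.ext (ZMod.val_injective _ h)
  · intro m hm
    obtain ⟨hm1, hm2⟩ : m < p ^ r ∧ m.Coprime (p ^ r) := by simpa using hm
    exact ⟨ZMod.unitOfCoprime m hm2, by simp, by simp [ZMod.val_cast_of_lt hm1]⟩
  · intro x _
    rw [ZMod.natCast_zmod_val, ZMod.inv_coe_unit]
    have h : (u : ZMod (p ^ r)) * x + (x⁻¹ : (ZMod (p ^ r))ˣ) =
        ((u * (x : ZMod (p ^ r)).val + ((x⁻¹ : (ZMod (p ^ r))ˣ) : ZMod (p ^ r)).val : ℤ) :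
          ZMod (p ^ r)) := by
      push_cast
      rw [ZMod.natCast_zmod_val, ZMod.natCast_zmod_val]
    rw [h, ZMod.stdAddChar_coe]
    push_cast
    rw [one_mul]

lemma S_eq_sum_unitKl (n : ℕ) : S n (p ^ r) = ∑ u, unitKl p r u ^ n := by
  rw [S, ← Equiv.sum_comp (Equiv.addRight 1)]
  refine Finset.sum_nbij (fun m => (m : ZMod (p ^ r))) (fun _ _ => mem_univ _) ?_ ?_ ?_
  · intro a ha b hb hab
    have := congrArg ZMod.val hab
    rwa [ZMod.val_cast_of_lt (by simpa using ha), ZMod.val_cast_of_lt (by simpa using hb)] at this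
  · intro u _
    exact ⟨u.val, by simpa using ZMod.val_lt u, by simp⟩
  · intro m _
    rw [Kl_eq_unitKl]
    simp

end PrimePower

lemma sum_choose_eq_two_mul {h : ℕ} (hh : 1 ≤ h) (P : ℕ → Prop) [DecidablePred P]
    (hP : ∀ j ≤ 2 * h, P (2 * h - j) ↔ P j) :
    ∑ j ∈ range (2 * h + 1) with P j, (2 * h).choose j =
      2 * ∑ i ∈ range (2 * h) with P (i + 1), (2 * h - 1).choose i := by
  obtain ⟨m, hm⟩ : ∃ m, 2 * h = m + 1 := ⟨2 * h - 1, by omega⟩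
  have hlast : ∑ j ∈ range (m + 1), (if P j then m.choose j else 0) =
      ∑ i ∈ range (m + 1), (if P (i + 1) then m.choose i else 0) := by
    rw [← Finset.sum_range_reflect]
    refine Finset.sum_congr rfl fun i hi => ?_
    have hi' := Finset.mem_range.1 hi
    have hPi := hP (i + 1) (by omega)
    rw [show 2 * h - (i + 1) = m - i by omega] at hPi
    simp only [show m + 1 - 1 - i = m - i by omega, hPi, Nat.choose_symm (show i ≤ m by omega)]
  have hshift : (∑ i ∈ range (m + 1), if P (i + 1) then m.choose (i + 1) else 0) +
      (if P 0 then 1 else 0) = ∑ j ∈ range (m + 1), (if P j then m.choose j else 0) := by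
    have := Finset.sum_range_succ' (fun j => if P j then m.choose j else 0) (m + 1)
    rw [Nat.choose_zero_right] at this
    rw [← this, Finset.sum_range_succ, Nat.choose_succ_self]
    simp
  simp only [Finset.sum_filter, hm, Nat.add_sub_cancel]
  rw [Finset.sum_range_succ', Nat.choose_zero_right]
  have hsplit : ∀ i, (if P (i + 1) then (m + 1).choose (i + 1) else 0) =
      (if P (i + 1) then m.choose i else 0) + if P (i + 1) then m.choose (i + 1) else 0 := by
    intro i
    rw [Nat.choose_succ_succ]
    split_ifs <;> rfl
  rw [Finset.sum_congr rfl fun i _ => hsplit i, Finset.sum_add_distrib, add_assoc, hshift, hlast,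
    two_mul]

lemma sum_choose_pred {m : ℕ} (P : ℕ → Prop) [DecidablePred P] :
    ∑ i ∈ range (m + 2) with P (i + 1), (m + 1).choose i =
      ∑ i ∈ range (m + 1),
        ((if P (i + 2) then m.choose i else 0) + if P (i + 1) then m.choose i else 0) := by
  have hshift : (∑ i ∈ range (m + 1), if P (i + 2) then m.choose (i + 1) else 0) +
      (if P 1 then 1 else 0) = ∑ j ∈ range (m + 1), (if P (j + 1) then m.choose j else 0) := by
    have := Finset.sum_range_succ' (fun j => if P (j + 1) then m.choose j else 0) (m + 1)
    rw [Nat.choose_zero_right] at this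
    rw [← this, Finset.sum_range_succ, Nat.choose_succ_self]
    simp
  have hsplit : ∀ i, (if P (i + 1 + 1) then (m + 1).choose (i + 1) else 0) =
      (if P (i + 2) then m.choose i else 0) + if P (i + 2) then m.choose (i + 1) else 0 := by
    intro i
    rw [Nat.choose_succ_succ]
    split_ifs <;> rfl
  rw [Finset.sum_filter, Finset.sum_range_succ', Nat.choose_zero_right,
    Finset.sum_congr rfl fun i _ => hsplit i, Finset.sum_add_distrib, add_assoc, zero_add, hshift,
    ← Finset.sum_add_distrib]

lemma sum_choose_modEq {p h : ℕ} (hp : 3 ≤ p) (hh : 1 ≤ h) :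
    ∑ j ∈ range (2 * h + 1) with (j ≠ h ∧ (p : ℤ) ∣ (j : ℤ) - h), (2 * h).choose j =
      2 * ∑ i ∈ range (2 * h - 1) with
        ((i % p = (h - 1) % p ∨ i % p = (h - 2) % p) ∧ i ≠ h - 1 ∧ i ≠ h - 2),
        (2 * h - 2).choose i := by
  rw [sum_choose_eq_two_mul hh]
  · congr 1
    obtain ⟨k, rfl⟩ : ∃ k, h = k + 1 := ⟨h - 1, by omega⟩
    rw [show 2 * (k + 1) = 2 * k + 2 by ring, show 2 * k + 2 - 1 = 2 * k + 1 by omega,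
      show 2 * k + 2 - 2 = 2 * k by omega,
      sum_choose_pred (fun j => j ≠ k + 1 ∧ (p : ℤ) ∣ (j : ℤ) - (k + 1 : ℕ)), Finset.sum_filter]
    refine Finset.sum_congr rfl fun i hi => ?_
    have hi' := Finset.mem_range.1 hi
    have h1 : (p : ℤ) ∣ ((i + 1 : ℕ) : ℤ) - (k + 1 : ℕ) ↔ i % p = k % p := by
      rw [show ((i + 1 : ℕ) : ℤ) - (k + 1 : ℕ) = i - k by push_cast; ring,
        ← Nat.modEq_iff_dvd]
      exact eq_comm
    rw [show k + 1 - 1 = k by omega]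
    simp only [h1]
    rcases Nat.eq_zero_or_pos k with rfl | hk
    · have hi0 : i = 0 := by omega
      subst hi0
      have : ¬ (p : ℤ) ∣ 1 := by
        intro hd
        have := Int.le_of_dvd one_pos hd
        omega
      simp [this]
    · have h2 : (p : ℤ) ∣ ((i + 2 : ℕ) : ℤ) - (k + 1 : ℕ) ↔ i % p = (k - 1) % p := by
        rw [show ((i + 2 : ℕ) : ℤ) - (k + 1 : ℕ) = i - (k - 1 : ℕ) by
          rw [Nat.cast_sub hk]; push_cast; ring, ← Nat.modEq_iff_dvd]
        exact eq_comm
      have h3 : k % p ≠ (k - 1) % p := by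
        intro he
        have hd := (Nat.modEq_iff_dvd' (Nat.sub_le k 1)).1 he.symm
        have := Nat.le_of_dvd (by omega) hd
        omega
      simp only [h2, show k + 1 - 2 = k - 1 by omega]
      have hne1 : i = k - 1 → i % p = (k - 1) % p := fun h => by rw [h]
      have hne2 : i = k → i % p = k % p := fun h => by rw [h]
      have e1 : i + 2 ≠ k + 1 ↔ i ≠ k - 1 := by omega
      have e2 : i + 1 ≠ k + 1 ↔ i ≠ k := by omega
      simp only [e1, e2]
      by_cases c1 : i % p = (k - 1) % p
      · have c2 : ¬ i % p = k % p := fun h => h3 (h.symm.trans c1)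
        have c3 : i ≠ k := fun h => c2 (hne2 h)
        simp [c1, h3.symm, c3]
      · have c3 : i ≠ k - 1 := fun h => c1 (hne1 h)
        by_cases c2 : i % p = k % p <;> simp [c1, c2, c3, h3]
  · intro j hj
    refine and_congr (by omega) ?_
    rw [Nat.cast_sub hj, ← dvd_neg]
    push_cast
    ring_nf

lemma two_mul_choose_pred {h : ℕ} (hh : 1 ≤ h) :
    2 * (2 * h - 1).choose (h - 1) = (2 * h).choose h := by
  obtain ⟨k, rfl⟩ : ∃ k, h = k + 1 := ⟨h - 1, by omega⟩
  rw [show 2 * (k + 1) - 1 = 2 * k + 1 by omega, show 2 * (k + 1) = 2 * k + 1 + 1 by ring,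
    Nat.add_sub_cancel, Nat.choose_succ_succ, ← Nat.choose_symm_half k, two_mul]

/-- Let `n ≥ 2` be even and `p` a prime with `p > max{2, √(n/2)}` (equivalently `p`
odd and `2p² > n`). Then for `r ≥ 3`,
`S_n(p^r) = C(n−1, n/2−1)·((p−1)/p)·p^((n/2+1)r)`, and
`S_n(p²) = C(n−1, n/2−1)·((p−1)/p)·p^(n+2) − p^(n+1)·∑* C(n−2,i)`, where `∑*` runs
over `0 ≤ i ≤ n−2` with `i ≡ n/2−1` or `i ≡ n/2−2 (mod p)`, excluding `i = n/2−1`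
and `i = n/2−2` themselves. -/
theorem even_moment_medium_prime (n p : ℕ) (hn : 2 ≤ n) (heven : Even n)
    (hp : p.Prime) (hpodd : p ≠ 2) (hpn : n < 2 * p ^ 2) :
    (∀ r : ℕ, 3 ≤ r →
      S n (p ^ r) =
        (Nat.choose (n - 1) (n / 2 - 1) : ℂ) * (((p : ℂ) - 1) / (p : ℂ)) *
          (p : ℂ) ^ ((n / 2 + 1) * r)) ∧
    S n (p ^ 2) =
      (Nat.choose (n - 1) (n / 2 - 1) : ℂ) * (((p : ℂ) - 1) / (p : ℂ)) *
          (p : ℂ) ^ (n + 2)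
        - (p : ℂ) ^ (n + 1) *
            ∑ i ∈ (Finset.range (n - 1)).filter
                (fun i => (i % p = (n / 2 - 1) % p ∨ i % p = (n / 2 - 2) % p) ∧
                  i ≠ n / 2 - 1 ∧ i ≠ n / 2 - 2),
              (Nat.choose (n - 2) i : ℂ) := by
  obtain ⟨h, rfl⟩ := heven.two_dvd
  have : Fact p.Prime := ⟨hp⟩
  have hp0 : (p : ℂ) ≠ 0 := by exact_mod_cast hp.ne_zero
  have hh : 1 ≤ h := by omega
  have hhp : h < p ^ 2 := by omega
  have hp3 : 3 ≤ p := by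
    have := hp.two_le
    omega
  have hchoose : (2 : ℂ) * ((2 * h - 1).choose (h - 1) : ℂ) = ((2 * h).choose h : ℂ) := by
    exact_mod_cast two_mul_choose_pred hh
  rw [Nat.mul_div_cancel_left h two_pos]
  constructor
  · intro r hr
    have hS := two_mul_sum_unitKl_pow (p := p) (r := r) (by omega) hpodd (n := 2 * h) (by omega)
    rw [← S_eq_sum_unitKl, sum_unitKl_sq_pow_of_three_le hr hpodd hhp, ← hchoose] at hS
    apply mul_left_cancel₀ (two_ne_zero (α := ℂ))
    rw [hS, show (h + 1) * r = (r - 1) + 1 + r * h by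
      rw [Nat.sub_add_cancel (by omega)]; ring, pow_add, pow_succ]
    field_simp
  · have hS := two_mul_sum_unitKl_pow (p := p) (r := 2) le_rfl hpodd (n := 2 * h) (by omega)
    have hsum := congrArg (Nat.cast (R := ℂ)) (sum_choose_modEq hp3 hh)
    push_cast at hsum
    rw [← S_eq_sum_unitKl, sum_unitKl_sq_pow_of_eq_two rfl hpodd hhp, ← hchoose, hsum] at hS
    apply mul_left_cancel₀ (two_ne_zero (α := ℂ))
    rw [hS]
    field_simp
    ring
end

section
/- For the fourth power moment at powers of 2: V_4(2^r) = (3/2)·(r−3)·2^{2r} for every integer r > 3, and S_4(2^r) = 3·2^{3r} for every integer r > 4. -/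
open Finset

/-- `V_n(q)`: number of tuples `(x_1,…,x_{n-1})` of units mod `q` with
`(x_1+⋯+x_{n-1})·(x_1⁻¹+⋯+x_{n-1}⁻¹) ≡ 1 (mod q)`. -/
noncomputable def V (n q : ℕ) : ℕ :=
  Nat.card {x : Fin (n - 1) → (ZMod q)ˣ //
    (∑ i, ((x i : ZMod q))) * (∑ i, (((x i)⁻¹ : (ZMod q)ˣ) : ZMod q)) = 1}

theorem sum_range_two_mul {M : Type*} [AddCommMonoid M] (f : ℕ → M) (N : ℕ) :
    ∑ i ∈ range (2 * N), f i = ∑ i ∈ range N, f (2 * i) + ∑ i ∈ range N, f (2 * i + 1) := by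
  induction N with
  | zero => simp
  | succ N ih =>
    rw [Nat.mul_succ, sum_range_succ, sum_range_succ, ih, sum_range_succ, sum_range_succ]
    abel

theorem sum_range_add_of_periodic {M : Type*} [AddCommMonoid M] (f : ℕ → M) (N : ℕ)
    (hf : ∀ i, f (i + N) = f i) (c : ℕ) :
    ∑ i ∈ range N, f (i + c) = ∑ i ∈ range N, f i := by
  induction c with
  | zero => simp
  | succ c ih =>
    rw [← ih]
    cases N with
    | zero => simp
    | succ N =>
      rw [sum_range_succ, sum_range_succ' (fun i => f (i + c))]
      refine congrArg₂ (· + ·) (sum_congr rfl fun i _ => by congr 1; ring) ?_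
      rw [Nat.zero_add, ← hf c]
      congr 1; ring

theorem sum_range_two_pow_dvd (n k : ℕ) :
    ∑ a ∈ range (2 ^ (n + k)), (if 2 ^ k ∣ a then 1 else 0) = 2 ^ n := by
  induction k with
  | zero => simp
  | succ k ih =>
    rw [← add_assoc, pow_succ' 2 (n + k), sum_range_two_mul]
    have h1 : ∀ i, (2 ^ (k + 1) ∣ 2 * i) ↔ 2 ^ k ∣ i := fun i => by
      rw [pow_succ', Nat.mul_dvd_mul_iff_left two_pos]
    have h2 : ∀ i, ¬ 2 ^ (k + 1) ∣ 2 * i + 1 := fun i h => by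
      have := (dvd_pow_self 2 (Nat.succ_ne_zero k)).trans h
      omega
    simp [h1, h2]
    simpa using ih

theorem sum_sum_four_mul_dvd (m : ℕ) : ∀ n, m ≤ n →
    ∑ a ∈ range (2 ^ n), ∑ b ∈ range (2 ^ n), (if 2 ^ (m + 1) ∣ 4 * (a * b) then 1 else 0)
      = (m + 1) * 2 ^ (2 * n - m) := by
  induction m using Nat.twoStepInduction with
  | zero =>
    intro n _
    have : ∀ a b, 2 ^ (0 + 1) ∣ 4 * (a * b) := fun a b => ⟨2 * (a * b), by ring⟩
    simp only [this, if_true]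
    simp; ring
  | one =>
    intro n hn
    have : ∀ a b, 2 ^ (1 + 1) ∣ 4 * (a * b) := fun a b => ⟨a * b, by ring⟩
    obtain ⟨k, rfl⟩ := Nat.exists_eq_add_of_le hn
    have e : 2 * (1 + k) - 1 = 2 * k + 1 := by omega
    simp only [this, if_true, e]
    simp; ring
  | more m ih _ =>
    intro n hn
    obtain ⟨k, rfl⟩ := Nat.exists_eq_add_of_le hn
    have key := ih (m + 1 + k) (by omega)
    have e1 : m + 2 + k = (m + 1 + k) + 1 := by omega
    rw [e1, pow_succ' 2 (m + 1 + k), sum_range_two_mul]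
    simp_rw [sum_range_two_mul]
    have hee : ∀ a b, 2 ^ (m + 2 + 1) ∣ 4 * (2 * a * (2 * b)) ↔ 2 ^ (m + 1) ∣ 4 * (a * b) :=
      fun a b => by
        rw [show 2 ^ (m + 2 + 1) = 4 * 2 ^ (m + 1) by ring,
          show 4 * (2 * a * (2 * b)) = 4 * (4 * (a * b)) by ring,
          Nat.mul_dvd_mul_iff_left (by norm_num)]
    have hodd : ∀ j b, Nat.Coprime (2 ^ j) (2 * b + 1) := fun j b =>
      Nat.Coprime.pow_left _ (by simp)
    have heo : ∀ a b, 2 ^ (m + 2 + 1) ∣ 4 * (2 * a * (2 * b + 1)) ↔ 2 ^ m ∣ a := fun a b => by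
      rw [show 2 ^ (m + 2 + 1) = 8 * 2 ^ m by ring,
        show 4 * (2 * a * (2 * b + 1)) = 8 * (a * (2 * b + 1)) by ring,
        Nat.mul_dvd_mul_iff_left (by norm_num), (hodd _ b).dvd_mul_right]
    have hoe : ∀ a b, 2 ^ (m + 2 + 1) ∣ 4 * ((2 * a + 1) * (2 * b)) ↔ 2 ^ m ∣ b := fun a b => by
      rw [mul_comm (2 * a + 1), heo]
    have hoo : ∀ a b, ¬ 2 ^ (m + 2 + 1) ∣ 4 * ((2 * a + 1) * (2 * b + 1)) := fun a b h => by
      rw [show 2 ^ (m + 2 + 1) = 4 * 2 ^ (m + 1) by ring,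
        Nat.mul_dvd_mul_iff_left (by norm_num), (hodd _ b).dvd_mul_right] at h
      have := (dvd_pow_self 2 (Nat.succ_ne_zero m)).trans h
      omega
    have hc := sum_range_two_pow_dvd (1 + k) m
    rw [show 1 + k + m = m + 1 + k by ring] at hc
    simp only [hee, heo, hoe, hoo, if_false, sum_const_zero, add_zero, sum_add_distrib, key,
      hc, sum_const, card_range, smul_eq_mul, ← mul_sum]
    rw [show 2 * (m + 1 + k) - m = m + 2 + 2 * k by omega,
      show 2 * (m + 1 + k + 1) - (m + 2) = m + 2 + 2 * k by omega]
    ring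

theorem sum_sum_two_pow_dvd (m n : ℕ) (h : m ≤ n) :
    ∑ s ∈ range (2 ^ (n + 1)), ∑ t ∈ range (2 ^ (n + 1)),
      (if 2 ^ (m + 1) ∣ (s + 1) * (t + 1) * (s + t + 1) then 1 else 0)
      = 3 * ((m + 1) * 2 ^ (2 * n - m)) := by
  have hodd : ∀ j b, Nat.Coprime (2 ^ j) (2 * b + 1) := fun j b =>
    Nat.Coprime.pow_left _ (by simp)
  rw [pow_succ' 2 n, sum_range_two_mul]
  simp_rw [sum_range_two_mul]
  have hee : ∀ a b, ¬ 2 ^ (m + 1) ∣ (2 * a + 1) * (2 * b + 1) * (2 * a + 2 * b + 1) :=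
    fun a b h => by
      rw [← mul_add, (hodd _ _).dvd_mul_right, (hodd _ _).dvd_mul_right] at h
      have := (dvd_pow_self 2 (Nat.succ_ne_zero m)).trans h
      omega
  have heo : ∀ a b, 2 ^ (m + 1) ∣ (2 * a + 1) * (2 * b + 1 + 1) * (2 * a + (2 * b + 1) + 1) ↔
      2 ^ (m + 1) ∣ 4 * ((a + (b + 1)) * (b + 1)) := fun a b => by
    rw [mul_assoc, (hodd _ _).dvd_mul_left]
    ring_nf
  have hoe : ∀ a b, 2 ^ (m + 1) ∣ (2 * a + 1 + 1) * (2 * b + 1) * (2 * a + 1 + 2 * b + 1) ↔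
      2 ^ (m + 1) ∣ 4 * ((a + 1) * (b + (a + 1))) := fun a b => by
    rw [mul_comm (2 * a + 1 + 1), mul_assoc, (hodd _ _).dvd_mul_left]
    ring_nf
  have hoo : ∀ a b, 2 ^ (m + 1) ∣
      (2 * a + 1 + 1) * (2 * b + 1 + 1) * (2 * a + 1 + (2 * b + 1) + 1) ↔
      2 ^ (m + 1) ∣ 4 * ((a + 1) * (b + 1)) := fun a b => by
    rw [show 2 * a + 1 + (2 * b + 1) + 1 = 2 * (a + b + 1) + 1 by ring, (hodd _ _).dvd_mul_right]
    ring_nf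
  simp only [hee, heo, hoe, hoo, if_false, sum_const_zero, zero_add, sum_add_distrib]
  have hd : 2 ^ (m + 1) ∣ 4 * 2 ^ n :=
    (pow_dvd_pow 2 (by omega : m + 1 ≤ n + 2)).trans ⟨1, by ring⟩
  have per : ∀ a b : ℕ, 2 ^ (m + 1) ∣ 4 * (a * (b + 2 ^ n)) ↔ 2 ^ (m + 1) ∣ 4 * (a * b) :=
    fun a b => by
      rw [show 4 * (a * (b + 2 ^ n)) = 4 * (a * b) + a * (4 * 2 ^ n) by ring]
      exact (Nat.dvd_add_iff_left (hd.mul_left a)).symm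
  have per' : ∀ a b : ℕ, 2 ^ (m + 1) ∣ 4 * ((a + 2 ^ n) * b) ↔ 2 ^ (m + 1) ∣ 4 * (a * b) :=
    fun a b => by rw [mul_comm (a + 2 ^ n), per, mul_comm b]
  have shift : ∀ a c : ℕ,
      ∑ b ∈ range (2 ^ n), (if 2 ^ (m + 1) ∣ 4 * (a * (b + c)) then 1 else 0)
        = ∑ b ∈ range (2 ^ n), (if 2 ^ (m + 1) ∣ 4 * (a * b) then 1 else 0) := fun a c =>
    sum_range_add_of_periodic (fun b => if 2 ^ (m + 1) ∣ 4 * (a * b) then 1 else 0) _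
      (fun b => by simp only [per]) c
  have shift' : ∑ a ∈ range (2 ^ n), ∑ b ∈ range (2 ^ n),
        (if 2 ^ (m + 1) ∣ 4 * ((a + 1) * b) then 1 else 0) = (m + 1) * 2 ^ (2 * n - m) := by
    rw [← sum_sum_four_mul_dvd m n h]
    exact sum_range_add_of_periodic
      (fun a => ∑ b ∈ range (2 ^ n), if 2 ^ (m + 1) ∣ 4 * (a * b) then 1 else 0) _
      (fun a => by simp only [per']) 1
  have first : ∑ a ∈ range (2 ^ n), ∑ b ∈ range (2 ^ n),
        (if 2 ^ (m + 1) ∣ 4 * ((a + (b + 1)) * (b + 1)) then 1 else 0)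
        = (m + 1) * 2 ^ (2 * n - m) := by
    rw [sum_comm, ← shift']
    refine sum_congr rfl fun b _ => ?_
    rw [← shift (b + 1) (b + 1)]
    exact sum_congr rfl fun a _ => by rw [mul_comm (b + 1)]
  simp only [shift, shift', first]
  ring

theorem sum_zmod_eq_sum_range {M : Type*} [AddCommMonoid M] (q : ℕ) [NeZero q]
    (f : ZMod q → M) : ∑ a, f a = ∑ i ∈ range q, f (i : ZMod q) := by
  refine sum_bij' (fun a _ => a.val) (fun i _ => (i : ZMod q)) ?_ ?_ ?_ ?_ ?_
  · intro a _; exact mem_range.2 (ZMod.val_lt a)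
  · intro i _; exact mem_univ _
  · intro a _; simp
  · intro i hi; exact ZMod.val_cast_of_lt (mem_range.1 hi)
  · intro a _; simp

theorem sum_units_eq_sum_range_coprime {M : Type*} [AddCommMonoid M] (q : ℕ) [NeZero q]
    (f : ZMod q → M) :
    ∑ x : (ZMod q)ˣ, f x = ∑ i ∈ range q, if Nat.Coprime i q then f (i : ZMod q) else 0 := by
  classical
  have h : ∑ x : (ZMod q)ˣ, f x = ∑ a : ZMod q, if IsUnit a then f a else 0 := by
    rw [← sum_filter]
    refine sum_bij (fun x _ => (x : ZMod q)) ?_ ?_ ?_ ?_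
    · intro x _; simp
    · intro x _ y _ h; exact Units.ext h
    · intro a ha
      obtain ⟨x, rfl⟩ := (mem_filter.1 ha).2
      exact ⟨x, mem_univ _, rfl⟩
    · intro x _; rfl
  rw [h, sum_zmod_eq_sum_range]
  refine sum_congr rfl fun i _ => ?_
  simp only [ZMod.isUnit_iff_coprime]

theorem sum_units_two_pow {M : Type*} [AddCommMonoid M] (n : ℕ) (f : ZMod (2 ^ (n + 1)) → M) :
    ∑ x : (ZMod (2 ^ (n + 1)))ˣ, f x = ∑ s ∈ range (2 ^ n), f (2 * s + 1) := by
  rw [sum_units_eq_sum_range_coprime]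
  rw [show range (2 ^ (n + 1)) = range (2 * 2 ^ n) by rw [pow_succ'], sum_range_two_mul]
  have h1 : ∀ i, ¬ Nat.Coprime (2 * i) (2 ^ (n + 1)) := fun i h => by
    have := h.coprime_dvd_left (dvd_mul_right 2 i)
    rw [Nat.coprime_pow_right_iff (Nat.succ_pos n)] at this
    simp at this
  have h2 : ∀ i, Nat.Coprime (2 * i + 1) (2 ^ (n + 1)) := fun i =>
    Nat.Coprime.pow_right _ (by simp)
  simp only [h1, if_false, sum_const_zero, zero_add]
  exact sum_congr rfl fun i _ => by rw [if_pos (h2 i)]; push_cast; rfl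

theorem sum_sum_units_two_pow (m n k : ℕ) (h : m ≤ n) (hk : m + 1 + k + 3 = n + 2) :
    ∑ x : (ZMod (2 ^ (n + 2)))ˣ, ∑ y : (ZMod (2 ^ (n + 2)))ˣ,
      (if 2 ^ k * ((1 + (x : ZMod (2 ^ (n + 2)))) * (1 + y) * (x + y)) = 0 then 1 else 0)
      = 3 * ((m + 1) * 2 ^ (2 * n - m)) := by
  rw [← sum_sum_two_pow_dvd m n h, sum_units_two_pow (n + 1) (fun x =>
    ∑ y : (ZMod (2 ^ (n + 2)))ˣ, (if 2 ^ k * ((1 + x) * (1 + y) * (x + y)) = 0 then 1 else 0))]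
  refine sum_congr rfl fun s _ => ?_
  rw [sum_units_two_pow (n + 1) (fun y =>
    (if 2 ^ k * ((1 + (2 * (s : ZMod (2 ^ (n + 2))) + 1)) * (1 + y) * ((2 * s + 1) + y)) = 0
      then 1 else 0))]
  refine sum_congr rfl fun t _ => if_congr ?_ rfl rfl
  have e : 2 ^ k * ((1 + (2 * (s : ZMod (2 ^ (n + 2))) + 1)) * (1 + (2 * t + 1)) *
      ((2 * s + 1) + (2 * t + 1)))
      = ((2 ^ k * 8 * ((s + 1) * (t + 1) * (s + t + 1)) : ℕ) : ZMod (2 ^ (n + 2))) := by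
    push_cast; ring
  rw [e, ZMod.natCast_eq_zero_iff, ← hk,
    show 2 ^ (m + 1 + k + 3) = 2 ^ k * 8 * 2 ^ (m + 1) by ring,
    Nat.mul_dvd_mul_iff_left (by positivity)]

theorem sum_mul_sum_inv_eq_one_iff {R : Type*} [CommRing R] (z x y : Rˣ) :
    ((x * z : Rˣ) + (y * z : Rˣ) + z : R) *
      (((x * z)⁻¹ : Rˣ) + ((y * z)⁻¹ : Rˣ) + (z⁻¹ : Rˣ)) = 1 ↔
    (1 + (x : R)) * (1 + y) * (x + y) = 0 := by
  have hx := x.mul_inv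
  have hy := y.mul_inv
  have hz := z.mul_inv
  rw [← sub_eq_zero, ← Units.mul_right_eq_zero (x * y)]
  simp only [mul_inv, Units.val_mul]
  generalize ((x⁻¹ : Rˣ) : R) = a at *
  generalize ((y⁻¹ : Rˣ) : R) = b at *
  generalize ((z⁻¹ : Rˣ) : R) = c at *
  generalize (x : R) = x at *
  generalize (y : R) = y at *
  generalize (z : R) = z at *
  have : x * y * ((x * z + y * z + z) * (a * c + b * c + c) - 1)
      = (1 + x) * (1 + y) * (x + y) := by
    linear_combination (x * y * (x + y + 1) * (a + b + 1)) * hz + y * (x + y + 1) * hx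
      + x * (x + y + 1) * hy
  rw [this]

theorem V_four_two_pow (n : ℕ) :
    V 4 (2 ^ (n + 1)) = 2 ^ n *
      ∑ x : (ZMod (2 ^ (n + 1)))ˣ, ∑ y : (ZMod (2 ^ (n + 1)))ˣ,
      (if (1 + (x : ZMod (2 ^ (n + 1)))) * (1 + y) * (x + y) = 0 then 1 else 0) := by
  classical
  let e : (ZMod (2 ^ (n + 1)))ˣ × (ZMod (2 ^ (n + 1)))ˣ × (ZMod (2 ^ (n + 1)))ˣ ≃
      (Fin 3 → (ZMod (2 ^ (n + 1)))ˣ) :=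
    { toFun := fun p => ![p.2.1 * p.1, p.2.2 * p.1, p.1]
      invFun := fun f => (f 2, f 0 * (f 2)⁻¹, f 1 * (f 2)⁻¹)
      left_inv := fun p => Prod.ext rfl
        (Prod.ext (mul_inv_cancel_right p.2.1 p.1) (mul_inv_cancel_right p.2.2 p.1))
      right_inv := fun f => by
        ext i
        fin_cases i
        · exact congrArg _ (inv_mul_cancel_right (f 0) (f 2))
        · exact congrArg _ (inv_mul_cancel_right (f 1) (f 2))
        · rfl }
  have h : V 4 (2 ^ (n + 1)) = Nat.card {p :
      (ZMod (2 ^ (n + 1)))ˣ × (ZMod (2 ^ (n + 1)))ˣ × (ZMod (2 ^ (n + 1)))ˣ //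
      (1 + (p.2.1 : ZMod (2 ^ (n + 1)))) * (1 + p.2.2) * (p.2.1 + p.2.2) = 0} := by
    refine Nat.card_congr (Equiv.subtypeEquiv e fun p => ?_).symm
    rw [← sum_mul_sum_inv_eq_one_iff p.1]
    simp [e, Fin.sum_univ_succ, add_assoc]
  rw [h, Nat.card_eq_fintype_card, Fintype.card_subtype, card_filter, Fintype.sum_prod_type]
  simp only [Fintype.sum_prod_type]
  trans ∑ _z : (ZMod (2 ^ (n + 1)))ˣ, ∑ x : (ZMod (2 ^ (n + 1)))ˣ, ∑ y : (ZMod (2 ^ (n + 1)))ˣ,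
      (if (1 + (x : ZMod (2 ^ (n + 1)))) * (1 + y) * (x + y) = 0 then 1 else 0)
  · exact sum_congr rfl fun _ _ => sum_congr rfl fun _ _ => sum_congr rfl fun _ _ =>
      if_congr Iff.rfl rfl rfl
  rw [sum_const, card_univ, smul_eq_mul, ZMod.card_units_eq_totient,
    Nat.totient_prime_pow Nat.prime_two n.succ_pos]
  simp

theorem Kl_eq_sum_units (q : ℕ) [NeZero q] (u v : ℤ) :
    Kl q u v = ∑ x : (ZMod q)ˣ,
      (ZMod.stdAddChar ((u : ZMod q) * (x : ZMod q) +
        (v : ZMod q) * ((x⁻¹ : (ZMod q)ˣ) : ZMod q)) : ℂ) := by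
  have := sum_units_eq_sum_range_coprime q
    (fun x => (ZMod.stdAddChar ((u : ZMod q) * x + (v : ZMod q) * x⁻¹) : ℂ))
  simp only [ZMod.inv_coe_unit] at this
  rw [this, Kl]
  refine sum_congr rfl fun x _ => ?_
  split_ifs with hx
  · have e : (u : ZMod q) * (x : ZMod q) + v * (x : ZMod q)⁻¹
        = ((u * x + v * (((x : ZMod q)⁻¹).val : ℤ) : ℤ) : ZMod q) := by
      push_cast
      simp
    rw [e, ZMod.stdAddChar_coe]
    push_cast
    rfl
  · rfl

theorem sum_stdAddChar_mul (q : ℕ) [NeZero q] (a : ZMod q) :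
    ∑ u : ZMod q, (ZMod.stdAddChar (u * a) : ℂ) = if a = 0 then (q : ℂ) else 0 := by
  rw [AddChar.sum_mulShift a (ZMod.isPrimitive_stdAddChar q), ZMod.card]
  split_ifs <;> simp

theorem two_mul_sum_units_stdAddChar (n : ℕ) (a : ZMod (2 ^ (n + 1))) :
    2 * ∑ w : (ZMod (2 ^ (n + 1)))ˣ, (ZMod.stdAddChar ((w : ZMod (2 ^ (n + 1))) * a) : ℂ)
      = 2 ^ (n + 1) * (2 * (if a = 0 then 1 else 0) - (if 2 * a = 0 then 1 else 0)) := by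
  let f : ℕ → ℂ := fun i => ZMod.stdAddChar ((i : ZMod (2 ^ (n + 1))) * a)
  have h1 := sum_stdAddChar_mul (2 ^ (n + 1)) a
  have h2 := sum_stdAddChar_mul (2 ^ (n + 1)) (2 * a)
  rw [sum_zmod_eq_sum_range] at h1 h2
  have hf : ∀ i : ℕ, (ZMod.stdAddChar ((i : ZMod (2 ^ (n + 1))) * (2 * a)) : ℂ) = f (2 * i) :=
    fun i => by simp only [f]; push_cast; ring_nf
  simp only [hf] at h2
  have hp : ∀ i, f (2 * (i + 2 ^ n)) = f (2 * i) := fun i => by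
    have : (2 : ZMod (2 ^ (n + 1))) * 2 ^ n = 0 := by
      rw [← pow_succ']; exact_mod_cast ZMod.natCast_self (2 ^ (n + 1))
    simp only [f]
    push_cast
    rw [mul_add, this, add_zero]
  have h3 : ∑ i ∈ range (2 ^ (n + 1)), f (2 * i) = 2 * ∑ i ∈ range (2 ^ n), f (2 * i) := by
    rw [pow_succ, mul_two, sum_range_add, two_mul]
    congr 1
    exact sum_congr rfl fun i _ => by rw [add_comm, hp]
  have h4 : ∑ i ∈ range (2 ^ (n + 1)), f i
      = ∑ i ∈ range (2 ^ n), f (2 * i) + ∑ i ∈ range (2 ^ n), f (2 * i + 1) := by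
    rw [pow_succ', sum_range_two_mul]
  have h5 := sum_units_two_pow n (fun w => (ZMod.stdAddChar (w * a) : ℂ))
  have h6 : ∑ s ∈ range (2 ^ n), (ZMod.stdAddChar ((2 * (s : ZMod (2 ^ (n + 1))) + 1) * a) : ℂ)
      = ∑ i ∈ range (2 ^ n), f (2 * i + 1) := sum_congr rfl fun i _ => by
    simp only [f]; push_cast; rfl
  rw [h5, h6]
  change ∑ i ∈ range (2 ^ (n + 1)), f i = _ at h1
  have h7 : (2 : ℂ) * ∑ i ∈ range (2 ^ n), f (2 * i + 1)
      = 2 * (if a = 0 then ((2 ^ (n + 1) : ℕ) : ℂ) else 0)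
        - (if 2 * a = 0 then ((2 ^ (n + 1) : ℕ) : ℂ) else 0) := by
    rw [← h1, ← h2, h3, h4]; ring
  rw [h7]
  push_cast
  split_ifs <;> ring

theorem S_four_eq (q : ℕ) [NeZero q] :
    S 4 q = q * ∑ x : (ZMod q)ˣ, ∑ y : (ZMod q)ˣ, ∑ z : (ZMod q)ˣ,
      if (x + y + z + 1 : ZMod q) = 0 then ∑ w : (ZMod q)ˣ, (ZMod.stdAddChar ((w : ZMod q) *
        (((x⁻¹ : (ZMod q)ˣ) : ZMod q) + ((y⁻¹ : (ZMod q)ˣ) : ZMod q)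
          + ((z⁻¹ : (ZMod q)ˣ) : ZMod q) + 1)) : ℂ) else 0 := by
  let ψ : ZMod q → ℂ := fun a => ZMod.stdAddChar a
  have hψ : ∀ a b, ψ (a + b) = ψ a * ψ b := fun a b => AddChar.map_add_eq_mul _ a b
  let K : ZMod q → ℂ := fun u => ∑ x : (ZMod q)ˣ, ψ (u * x + ((x⁻¹ : (ZMod q)ˣ) : ZMod q))
  have hS : S 4 q = ∑ u : ZMod q, K u ^ 4 := by
    rw [← Equiv.sum_comp (Equiv.addRight (1 : ZMod q)), sum_zmod_eq_sum_range, S]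
    refine sum_congr rfl fun u _ => ?_
    rw [Kl_eq_sum_units]
    simp [K, ψ]
  have hK : ∀ (u : ZMod q) (w : (ZMod q)ˣ), K u = ∑ x : (ZMod q)ˣ,
      ψ (u * w * x + (w⁻¹ : (ZMod q)ˣ) * (x⁻¹ : (ZMod q)ˣ)) := fun u w => by
    refine (Equiv.sum_comp (Equiv.mulLeft w) (fun x : (ZMod q)ˣ =>
      ψ (u * x + ((x⁻¹ : (ZMod q)ˣ) : ZMod q)))).symm.trans (sum_congr rfl fun x _ => ?_)
    simp [mul_assoc, mul_comm (x⁻¹ : (ZMod q)ˣ).val]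
  have hK4 : ∀ u, K u ^ 4 = ∑ w : (ZMod q)ˣ, ∑ x : (ZMod q)ˣ, ∑ y : (ZMod q)ˣ, ∑ z : (ZMod q)ˣ,
      ψ ((u * w) * (x + y + z + 1)) * ψ ((w⁻¹ : (ZMod q)ˣ) *
        (((x⁻¹ : (ZMod q)ˣ) : ZMod q) + ((y⁻¹ : (ZMod q)ˣ) : ZMod q)
          + ((z⁻¹ : (ZMod q)ˣ) : ZMod q) + 1)) := fun u => by
    have : K u ^ 4 = ∑ w : (ZMod q)ˣ, ψ (u * w + ((w⁻¹ : (ZMod q)ˣ) : ZMod q)) *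
        (K u * K u * K u) := by
      rw [← sum_mul]; change _ = K u * _; ring
    rw [this]
    refine sum_congr rfl fun w _ => ?_
    rw [hK u w, sum_mul_sum, sum_mul, mul_sum]
    refine sum_congr rfl fun x _ => ?_
    rw [sum_mul, mul_sum]
    refine sum_congr rfl fun y _ => ?_
    rw [mul_sum, mul_sum]
    refine sum_congr rfl fun z _ => ?_
    simp only [← hψ]
    congr 1; ring
  have hu : ∀ (w : (ZMod q)ˣ) (a : ZMod q),
      ∑ u : ZMod q, ψ (u * w * a) = if a = 0 then (q : ℂ) else 0 := fun w a => by
    rw [← sum_stdAddChar_mul]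
    exact Equiv.sum_comp (Units.mulRight w) (fun u => ψ (u * a))
  simp_rw [hS, hK4]
  rw [sum_comm]
  have hw : ∀ w : (ZMod q)ˣ, ∑ u : ZMod q, ∑ x : (ZMod q)ˣ, ∑ y : (ZMod q)ˣ, ∑ z : (ZMod q)ˣ,
      ψ ((u * w) * (x + y + z + 1)) * ψ ((w⁻¹ : (ZMod q)ˣ) *
        (((x⁻¹ : (ZMod q)ˣ) : ZMod q) + ((y⁻¹ : (ZMod q)ˣ) : ZMod q)
          + ((z⁻¹ : (ZMod q)ˣ) : ZMod q) + 1))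
      = ∑ x : (ZMod q)ˣ, ∑ y : (ZMod q)ˣ, ∑ z : (ZMod q)ˣ,
        (if (x + y + z + 1 : ZMod q) = 0 then (q : ℂ) else 0) * ψ ((w⁻¹ : (ZMod q)ˣ) *
        (((x⁻¹ : (ZMod q)ˣ) : ZMod q) + ((y⁻¹ : (ZMod q)ˣ) : ZMod q)
          + ((z⁻¹ : (ZMod q)ˣ) : ZMod q) + 1)) := fun w => by
    rw [sum_comm]
    refine sum_congr rfl fun x _ => ?_
    rw [sum_comm]
    refine sum_congr rfl fun y _ => ?_
    rw [sum_comm]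
    refine sum_congr rfl fun z _ => ?_
    rw [← sum_mul, hu]
  simp_rw [hw]
  rw [← Equiv.sum_comp (Equiv.inv (ZMod q)ˣ), sum_comm, mul_sum]
  refine sum_congr rfl fun x _ => ?_
  rw [sum_comm, mul_sum]
  refine sum_congr rfl fun y _ => ?_
  rw [sum_comm, mul_sum]
  refine sum_congr rfl fun z _ => ?_
  split_ifs <;> simp [mul_sum, ψ]

theorem inv_sum_mul_eq {R : Type*} [CommRing R] (x y z : Rˣ) (h : (x + y + z + 1 : R) = 0) :
    ((x * y * z : Rˣ) : R) * ((x⁻¹ : Rˣ) + (y⁻¹ : Rˣ) + (z⁻¹ : Rˣ) + 1)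
      = -((1 + (x : R)) * (1 + y) * (x + y)) := by
  have hx := x.mul_inv
  have hy := y.mul_inv
  have hz := z.mul_inv
  simp only [Units.val_mul]
  linear_combination (y * z : R) * hx + (x * z : R) * hy + (x * y : R) * hz
    + ((x : R) * y + x + y) * h

theorem exists_unit_eq_neg (n : ℕ) (x y : (ZMod (2 ^ (n + 1)))ˣ) :
    ∃ z : (ZMod (2 ^ (n + 1)))ˣ, (z : ZMod (2 ^ (n + 1))) = -(x + y + 1) := by
  have hval : ∀ x : (ZMod (2 ^ (n + 1)))ˣ, ∃ s : ℕ, (x : ZMod (2 ^ (n + 1))) = 2 * s + 1 := by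
    intro x
    have hc := ZMod.val_coe_unit_coprime x
    have ho : Odd (x : ZMod (2 ^ (n + 1))).val :=
      Nat.coprime_two_right.1 (hc.coprime_dvd_right (dvd_pow_self 2 n.succ_ne_zero))
    obtain ⟨s, hs⟩ := ho
    refine ⟨s, ?_⟩
    have := congrArg (Nat.cast : ℕ → ZMod (2 ^ (n + 1))) hs
    simpa using this
  obtain ⟨s, hs⟩ := hval x
  obtain ⟨t, ht⟩ := hval y
  have : IsUnit (-((x : ZMod (2 ^ (n + 1))) + y + 1)) := by
    rw [IsUnit.neg_iff, hs, ht, show (2 * (s : ZMod (2 ^ (n + 1))) + 1 + (2 * t + 1) + 1)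
      = ((2 * (s + t + 1) + 1 : ℕ) : ZMod (2 ^ (n + 1))) by push_cast; ring,
      ZMod.isUnit_iff_coprime]
    exact Nat.Coprime.pow_right _ (by simp)
  exact ⟨this.unit, rfl⟩

theorem two_mul_S_four_two_pow (n : ℕ) :
    2 * S 4 (2 ^ (n + 1)) = (2 ^ (n + 1)) ^ 2 *
      (2 * ((∑ x : (ZMod (2 ^ (n + 1)))ˣ, ∑ y : (ZMod (2 ^ (n + 1)))ˣ,
        (if 2 ^ 0 * ((1 + (x : ZMod (2 ^ (n + 1)))) * (1 + y) * (x + y)) = 0 then 1 else 0) : ℕ) : ℂ)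
      - ((∑ x : (ZMod (2 ^ (n + 1)))ˣ, ∑ y : (ZMod (2 ^ (n + 1)))ˣ,
        (if 2 ^ 1 * ((1 + (x : ZMod (2 ^ (n + 1)))) * (1 + y) * (x + y)) = 0 then 1 else 0) : ℕ)
          : ℂ)) := by
  rw [S_four_eq]
  push_cast
  rw [mul_left_comm, sq, mul_assoc]
  congr 1
  simp only [mul_sum, ← sum_sub_distrib]
  refine sum_congr rfl fun x _ => sum_congr rfl fun y _ => ?_
  obtain ⟨z, hz⟩ := exists_unit_eq_neg n x y
  have h0 : (x + y + z + 1 : ZMod (2 ^ (n + 1))) = 0 := by rw [hz]; ring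
  rw [sum_eq_single z]
  · rw [if_pos h0, two_mul_sum_units_stdAddChar]
    have e := inv_sum_mul_eq x y z h0
    congr 3
    · refine if_congr ?_ rfl rfl
      rw [← Units.mul_right_eq_zero (x * y * z), e, neg_eq_zero, pow_zero, one_mul]
    · apply propext
      rw [← Units.mul_right_eq_zero (x * y * z), mul_left_comm, e, mul_neg, neg_eq_zero, pow_one]
  · intro z' _ hne
    rw [if_neg, mul_zero]
    intro h
    apply hne
    ext
    rw [hz]
    linear_combination h
  · intro h; exact absurd (mem_univ z) h

/-- For the fourth power moment at powers of `2`: `V_4(2^r) = (3/2)·(r−3)·2^(2r)` for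
`r > 3`, and `S_4(2^r) = 3·2^(3r)` for `r > 4`. -/
theorem fourth_moment_powers_of_two :
    (∀ r : ℕ, 3 < r → (V 4 (2 ^ r) : ℝ) = 3 / 2 * ((r : ℝ) - 3) * 2 ^ (2 * r)) ∧
    (∀ r : ℕ, 4 < r → S 4 (2 ^ r) = 3 * (2 : ℂ) ^ (3 * r)) := by
  constructor
  · intro r hr
    obtain ⟨m, rfl⟩ := Nat.exists_eq_add_of_lt hr
    have h := sum_sum_units_two_pow m (m + 2) 0 (by omega) (by omega)
    simp only [pow_zero, one_mul] at h
    rw [show 3 + m + 1 = m + 2 + 1 + 1 by ring, V_four_two_pow, h,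
      show 2 * (m + 2) - m = m + 4 by omega]
    push_cast
    ring
  · intro r hr
    obtain ⟨m, rfl⟩ := Nat.exists_eq_add_of_lt hr
    have h0 := sum_sum_units_two_pow (m + 1) (m + 3) 0 (by omega) (by omega)
    have h1 := sum_sum_units_two_pow m (m + 3) 1 (by omega) (by omega)
    have h := two_mul_S_four_two_pow (m + 3 + 1)
    rw [h0, h1, show 2 * (m + 3) - m = m + 6 by omega,
      show 2 * (m + 3) - (m + 1) = m + 5 by omega] at h
    rw [show 4 + m + 1 = m + 3 + 1 + 1 by ring]
    apply mul_left_cancel₀ (two_ne_zero' ℂ)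
    rw [h]
    push_cast
    ring
end
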